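/- Vorticity maximum principle in two dimensions: let d = 2, ν ≥ 0, p > 2, and let (u, X) solve the stochastic system X_{t,s}(x) = x + ∫_t^s u_r(X_{t,r}(x)) dr + √(2ν)(W_s − W_t), u_t = P𝔼[(∇^t X_{t,0})(u₀∘X_{t,0})] on an interval [−T,0], with u₀ ∈ W^{2,p}(ℝ²;ℝ²) divergence free. Then the vorticity ω_t := curl u_t = ∂₁u²_t − ∂₂u¹_t admits the representation ω_t = 𝔼[ω₀∘X_{t,0}] where ω₀ = curl u₀, and consequently ‖ω_t‖_q ≤ ‖ω₀‖_q for every 1 ≤ q ≤ ∞ and every t ∈ [−T,0]. -/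

import Mathlib

open MeasureTheory ProbabilityTheory Filter Set
open scoped ENNReal NNReal Topology

noncomputable section

abbrev Euc (d : ℕ) := EuclideanSpace ℝ (Fin d)

/-- `i`-th standard basis vector of `ℝ^d`. -/
def ee {d : ℕ} (i : Fin d) : Euc d := EuclideanSpace.single i 1

/-- Divergence `∇·u` of a vector field. -/
def divg {d : ℕ} (u : Euc d → Euc d) (x : Euc d) : ℝ :=
  ∑ i, fderiv ℝ u x (ee i) i

/-- Action of the transposed Jacobi matrix `∇^t u (x)`. -/
def tJac {d : ℕ} (u : Euc d → Euc d) (x : Euc d) : Euc d →L[ℝ] Euc d :=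
  ContinuousLinearMap.adjoint (fderiv ℝ u x)

/-- Supremum norm (valued in `ℝ≥0∞`). -/
def supNorm {α F : Type*} [NormedAddCommGroup F] (f : α → F) : ℝ≥0∞ :=
  ⨆ x, (‖f x‖₊ : ℝ≥0∞)

/-- `∑_{j=a}^{b} ‖∇^j f‖_{L^p}`; e.g. `wNorm 0 k p f` is the Sobolev norm
`‖f‖_{k,p}` and `wNorm 1 (k+1) p f` is `‖∇f‖_{k,p}`. -/
def wNorm {d : ℕ} {F : Type*} [NormedAddCommGroup F] [NormedSpace ℝ F]
    (a b : ℕ) (p : ℝ) (f : Euc d → F) : ℝ≥0∞ :=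
  ∑ j ∈ Finset.Icc a b, eLpNorm (iteratedFDeriv ℝ j f) (ENNReal.ofReal p) volume

/-- Membership in the Sobolev space `W^{k,p}(ℝ^d)`. -/
def MemW {d : ℕ} {F : Type*} [NormedAddCommGroup F] [NormedSpace ℝ F]
    (k : ℕ) (p : ℝ) (f : Euc d → F) : Prop :=
  ContDiff ℝ k f ∧ wNorm 0 k p f < ∞

/-- Membership in the Banach space `𝕏^{k+2,p}` of transformations of `ℝ^d`. -/
def MemX {d : ℕ} (k : ℕ) (p : ℝ) (X : Euc d → Euc d) : Prop :=
  ContDiff ℝ (k+2) X ∧ supNorm (fderiv ℝ X) < ∞ ∧ wNorm 2 (k+2) p X < ∞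

/-- Characterizing properties of the Leray–Hodge projection `P = I - ∇(-Δ)⁻¹ div`:
it differs from the identity by a gradient, kills gradients, produces
divergence-free fields, and is `L^p`-bounded for all `1 < p < ∞`. -/
def IsLerayProjection {d : ℕ} (P : (Euc d → Euc d) → (Euc d → Euc d)) : Prop :=
  (∀ f, ∃ q : Euc d → ℝ, ∀ x, f x = P f x + gradient q x) ∧
  (∀ q : Euc d → ℝ, Differentiable ℝ q → P (fun x => gradient q x) = 0) ∧
  (∀ f, Differentiable ℝ (P f) → ∀ x, divg (P f) x = 0) ∧
  (∀ p : ℝ, 1 < p → ∃ C : ℝ≥0, 0 < C ∧ ∀ f,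
    eLpNorm (P f) (ENNReal.ofReal p) volume ≤ C * eLpNorm f (ENNReal.ofReal p) volume)

/-- A standard `d`-dimensional Brownian motion (indexed by `ℝ`). -/
structure IsBrownianMotion {Ω : Type*} [MeasureSpace Ω] {d : ℕ}
    (W : ℝ → Ω → Euc d) : Prop where
  meas : ∀ t, Measurable (W t)
  start : ∀ᵐ ω ∂(ℙ : Measure Ω), W 0 ω = 0
  cont : ∀ᵐ ω ∂(ℙ : Measure Ω), Continuous fun t => W t ω
  coord_indep : ∀ s t : ℝ, s ≤ t →
    iIndepFun (fun (i : Fin d) ω => W t ω i - W s ω i) ℙ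
  incr_indep : ∀ (n : ℕ) (ts : Fin (n+1) → ℝ), Monotone ts →
    iIndepFun
      (fun (k : Fin n) ω => W (ts k.succ) ω - W (ts k.castSucc) ω) ℙ
  gauss : ∀ s t : ℝ, s ≤ t → ∀ i : Fin d,
    Measure.map (fun ω => W t ω i - W s ω i) ℙ = gaussianReal 0 (Real.toNNReal (t - s))

/-- Vector-valued Laplacian `Δf`. -/
def vLap {d : ℕ} (f : Euc d → Euc d) (x : Euc d) : Euc d :=
  ∑ i, iteratedFDeriv ℝ 2 f x ![ee i, ee i]


/-- `(u,X)` solves the stochastic Lagrangian system for backward Navier–Stokes on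
`[-T,0]`: `X` is the stochastic flow of `u` driven by `√(2ν) W`,
`u_t = P𝔼[(∇^t X_{t,0})(u₀ ∘ X_{t,0})]`, and `u ∈ C([-T,0]; W^{k+2,p})`. -/
def SolvesLocalSystem {Ω : Type*} [MeasureSpace Ω] {d : ℕ}
    (P : (Euc d → Euc d) → (Euc d → Euc d)) (W : ℝ → Ω → Euc d)
    (ν : ℝ) (k : ℕ) (p T : ℝ) (u₀ : Euc d → Euc d)
    (u : ℝ → Euc d → Euc d) (X : ℝ → ℝ → Euc d → Ω → Euc d) : Prop :=
  (∀ᵐ ω ∂(ℙ : Measure Ω), ∀ (x : Euc d) (t s : ℝ), -T ≤ t → t ≤ s → s ≤ 0 →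
    X t s x ω = x + (∫ r in t..s, u r (X t r x ω))
      + Real.sqrt (2*ν) • (W s ω - W t ω)) ∧
  (∀ t ∈ Icc (-T) (0:ℝ), u t =
    P (fun x => ∫ ω, (tJac (fun y => X t 0 y ω) x) (u₀ (X t 0 x ω)) ∂(ℙ : Measure Ω))) ∧
  (∀ t ∈ Icc (-T) (0:ℝ), ContDiff ℝ (k+2) (u t) ∧ wNorm 0 (k+2) p (u t) < ∞) ∧
  (∀ t₀ ∈ Icc (-T) (0:ℝ),
    Tendsto (fun t => wNorm 0 (k+2) p (fun x => u t x - u t₀ x)) (𝓝[Icc (-T) 0] t₀) (𝓝 0))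

/-- Scalar vorticity `curl u = ∂₁u² - ∂₂u¹` in two dimensions. -/
def curl2 (u : Euc 2 → Euc 2) (x : Euc 2) : ℝ :=
  fderiv ℝ u x (ee 0) 1 - fderiv ℝ u x (ee 1) 0

/-! ## Part 1 -/
/-- Hölder inequality on a set. -/
lemma vr_holder_set {F : Type*} [NormedAddCommGroup F] (p : ℝ) (hp : 1 ≤ p)
    (f : Euc 2 → F) (hf : AEStronglyMeasurable f volume) (A : Set (Euc 2)) :
    ∫⁻ x in A, ‖f x‖ₑ ≤ eLpNorm f (ENNReal.ofReal p) volume * volume A ^ (1 - 1 / p) := by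
  have h := eLpNorm_le_eLpNorm_mul_rpow_measure_univ (μ := volume.restrict A) (f := f)
    (p := 1) (q := ENNReal.ofReal p) (by simpa using ENNReal.ofReal_le_ofReal hp) hf.restrict
  rw [eLpNorm_one_eq_lintegral_enorm] at h
  refine h.trans ?_
  simp only [Measure.restrict_apply_univ, ENNReal.toReal_one, div_one,
    ENNReal.toReal_ofReal (zero_le_one.trans hp)]
  gcongr
  exact Measure.restrict_le_self

lemma vr_eLpNorm_eq {F : Type*} [NormedAddCommGroup F] (p : ℝ) (hp : 1 ≤ p)
    (f : Euc 2 → F) : eLpNorm f (ENNReal.ofReal p) volume = (∫⁻ x, ‖f x‖ₑ ^ p) ^ (1 / p) := by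
  have hp0 : 0 < p := by linarith
  rw [eLpNorm_eq_lintegral_rpow_enorm_toReal (by simpa using hp0) ENNReal.ofReal_ne_top,
    ENNReal.toReal_ofReal hp0.le]

lemma vr_scaling {F : Type*} [NormedAddCommGroup F] (p : ℝ) (hp : 1 ≤ p)
    (f : Euc 2 → F) (hf : Continuous f) (x : Euc 2) (s : ℝ) (hs : 0 < s) :
    eLpNorm (fun y => f (x + s • y)) (ENNReal.ofReal p) volume
      = ENNReal.ofReal (s ^ (-2 / p)) * eLpNorm f (ENNReal.ofReal p) volume := by
  have hp0 : 0 < p := by linarith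
  rw [vr_eLpNorm_eq p hp, vr_eLpNorm_eq p hp]
  have hm : Measurable (fun z : Euc 2 => ‖f (x + z)‖ₑ ^ p) := by
    have : Continuous fun z : Euc 2 => f (x + z) := by fun_prop
    exact (this.enorm.measurable).pow_const _
  have h1 : ∫⁻ y : Euc 2, ‖f (x + s • y)‖ₑ ^ p
      = ENNReal.ofReal (s ^ (-2 : ℝ)) * ∫⁻ y, ‖f y‖ₑ ^ p := by
    have := lintegral_map (μ := (volume : Measure (Euc 2))) hm (measurable_const_smul s)
    rw [← this, Measure.map_addHaar_smul _ hs.ne', lintegral_smul_measure,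
      lintegral_add_left_eq_self (fun z => ‖f z‖ₑ ^ p) x]
    simp only [finrank_euclideanSpace, Fintype.card_fin, smul_eq_mul]
    congr 2
    rw [Real.rpow_neg hs.le, abs_of_pos (by positivity)]
    norm_num
  rw [h1, ENNReal.mul_rpow_of_nonneg _ _ (by positivity),
    ENNReal.ofReal_rpow_of_nonneg (by positivity) (by positivity), ← Real.rpow_mul hs.le]
  congr 3
  ring

lemma vr_morrey {F : Type*} [NormedAddCommGroup F] [NormedSpace ℝ F] [CompleteSpace F]
    (p : ℝ) (hp : 2 < p) : ∃ C : ℝ≥0, ∀ f : Euc 2 → F, ContDiff ℝ 1 f → ∀ x,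
      ‖f x‖ₑ ≤ C * (eLpNorm f (ENNReal.ofReal p) volume
        + eLpNorm (fderiv ℝ f) (ENNReal.ofReal p) volume) := by
  have hp1 : 1 ≤ p := by linarith
  set B : Set (Euc 2) := Metric.ball 0 1 with hB
  have hBpos : volume B ≠ 0 := (Metric.measure_ball_pos _ _ one_pos).ne'
  have hBfin : volume B ≠ ∞ := measure_ball_lt_top.ne
  set V := volume B ^ (1 - 1 / p) with hV
  have hVfin : V ≠ ∞ := ENNReal.rpow_ne_top_of_nonneg (by
    have : 1 / p ≤ 1 := by rw [div_le_one (by linarith)]; exact hp1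
    linarith) hBfin
  set S : ℝ≥0∞ := ∫⁻ s in Ioo (0:ℝ) 1, ENNReal.ofReal (s ^ (-2 / p)) with hS
  have hSfin : S ≠ ∞ := by
    have h := intervalIntegral.intervalIntegrable_rpow' (a := 0) (b := 1) (r := -2 / p) (by
      rw [lt_div_iff₀ (by linarith)]; linarith)
    rw [intervalIntegrable_iff_integrableOn_Ioo_of_le zero_le_one] at h
    have h2 := h.hasFiniteIntegral
    rw [hasFiniteIntegral_iff_enorm] at h2
    refine ne_of_lt (lt_of_le_of_lt (lintegral_mono fun s => ?_) h2)
    exact Real.ofReal_le_enorm _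
  set C : ℝ≥0∞ := (volume B)⁻¹ * (V * (1 + S)) with hC
  have hCfin : C ≠ ∞ := by
    refine ENNReal.mul_ne_top (ENNReal.inv_ne_top.2 hBpos) (ENNReal.mul_ne_top hVfin ?_)
    simp [hSfin]
  refine ⟨C.toNNReal, fun f hf x => ?_⟩
  rw [ENNReal.coe_toNNReal hCfin]
  set a := eLpNorm f (ENNReal.ofReal p) volume
  set b := eLpNorm (fderiv ℝ f) (ENNReal.ofReal p) volume
  have hcf : Continuous f := hf.continuous
  have hcd : Continuous (fderiv ℝ f) := hf.continuous_fderiv (by norm_num)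
  have key : ∀ y ∈ B, ‖f x‖ₑ ≤ ‖f (x + y)‖ₑ
      + ∫⁻ s in Ioo (0:ℝ) 1, ‖fderiv ℝ f (x + s • y)‖ₑ := by
    intro y hy
    have hder : ∀ s ∈ uIcc (0:ℝ) 1, HasDerivAt (fun s : ℝ => f (x + s • y))
        (fderiv ℝ f (x + s • y) y) s := by
      intro s _
      have h1 : HasDerivAt (fun s : ℝ => x + s • y) y s := by
        simpa using ((hasDerivAt_id s).smul_const y).const_add x
      exact ((hf.differentiable (by norm_num)) (x + s • y)).hasFDerivAt.comp_hasDerivAt s h1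
    have hcont : Continuous fun s : ℝ => fderiv ℝ f (x + s • y) y :=
      (hcd.comp (by fun_prop)).clm_apply continuous_const
    have hi := intervalIntegral.integral_eq_sub_of_hasDerivAt hder (hcont.intervalIntegrable _ _)
    have e1 : f x = f (x + y) - ∫ s in (0:ℝ)..1, fderiv ℝ f (x + s • y) y := by
      rw [hi]; simp
    have e2 : ‖f x‖ₑ ≤ ‖f (x + y)‖ₑ + ‖∫ s in (0:ℝ)..1, fderiv ℝ f (x + s • y) y‖ₑ := by
      conv_lhs => rw [e1]
      exact enorm_sub_le
    refine e2.trans ?_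
    gcongr
    rw [intervalIntegral.integral_of_le zero_le_one, integral_Ioc_eq_integral_Ioo]
    refine (enorm_integral_le_lintegral_enorm _).trans (lintegral_mono fun s => ?_)
    refine ((fderiv ℝ f (x + s • y)).le_opENorm y).trans ?_
    have : ‖y‖ₑ ≤ 1 := by
      rw [hB, mem_ball_zero_iff] at hy
      rw [← ofReal_norm]
      simpa using ENNReal.ofReal_le_ofReal hy.le
    calc _ ≤ ‖fderiv ℝ f (x + s • y)‖ₑ * 1 := by gcongr
      _ = _ := mul_one _
  have hint : volume B * ‖f x‖ₑ ≤ V * (1 + S) * (a + b) := by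
    have m2 : Measurable (Function.uncurry fun (y : Euc 2) (s : ℝ) =>
        ‖fderiv ℝ f (x + s • y)‖ₑ) := by
      have : Continuous (Function.uncurry fun (y : Euc 2) (s : ℝ) =>
        fderiv ℝ f (x + s • y)) := hcd.comp (by fun_prop)
      exact this.enorm.measurable
    calc volume B * ‖f x‖ₑ = ∫⁻ y in B, ‖f x‖ₑ := by
          rw [setLIntegral_const, mul_comm]
      _ ≤ ∫⁻ y in B, (‖f (x + y)‖ₑ + ∫⁻ s in Ioo (0:ℝ) 1, ‖fderiv ℝ f (x + s • y)‖ₑ) :=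
          setLIntegral_mono' measurableSet_ball key
      _ = (∫⁻ y in B, ‖f (x + y)‖ₑ)
          + ∫⁻ y in B, ∫⁻ s in Ioo (0:ℝ) 1, ‖fderiv ℝ f (x + s • y)‖ₑ := by
          rw [lintegral_add_left]
          exact (hcf.comp (by fun_prop : Continuous fun y : Euc 2 => x + y)).enorm.measurable
      _ = (∫⁻ y in B, ‖f (x + y)‖ₑ)
          + ∫⁻ s in Ioo (0:ℝ) 1, ∫⁻ y in B, ‖fderiv ℝ f (x + s • y)‖ₑ := by
          congr 1
          rw [lintegral_lintegral_swap m2.aemeasurable]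
      _ ≤ a * V + ∫⁻ s in Ioo (0:ℝ) 1, (ENNReal.ofReal (s ^ (-2 / p)) * (b * V)) := by
          gcongr ?_ + ?_
          · refine (vr_holder_set p hp1 (fun y => f (x + y))
              (hcf.comp (by fun_prop)).aestronglyMeasurable B).trans ?_
            have := vr_scaling p hp1 f hcf x 1 one_pos
            simp only [one_smul, Real.one_rpow, ENNReal.ofReal_one, one_mul] at this
            rw [this]
          · refine setLIntegral_mono' measurableSet_Ioo fun s hs => ?_
            refine (vr_holder_set p hp1 (fun y => fderiv ℝ f (x + s • y))
              (hcd.comp (by fun_prop)).aestronglyMeasurable B).trans ?_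
            rw [vr_scaling p hp1 _ hcd x s hs.1, mul_assoc]
      _ = a * V + S * (b * V) := by
          rw [lintegral_mul_const]
          exact ENNReal.measurable_ofReal.comp (measurable_id.pow_const _)
      _ ≤ V * (1 + S) * (a + b) := by
          have : V * (1 + S) * (a + b) = a * V + S * (b * V) + (S * (a * V) + b * V) := by ring
          rw [this]; exact le_self_add
  calc ‖f x‖ₑ = (volume B)⁻¹ * (volume B * ‖f x‖ₑ) := by
        rw [← mul_assoc, ENNReal.inv_mul_cancel hBpos hBfin, one_mul]
    _ ≤ (volume B)⁻¹ * (V * (1 + S) * (a + b)) := by gcongr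
    _ = _ := by rw [hC]; ring

/-! ## Part 2 -/
lemma vr_dq {ζ k : Euc 2 → ℝ} (hζ : ContDiff ℝ 1 ζ) (hc : HasCompactSupport ζ)
    (hk : Continuous k) (v : Euc 2) :
    Tendsto (fun t : ℝ => ∫ x, (t⁻¹ • (ζ (x + t • v) - ζ x)) * k x) (𝓝[>] 0)
      (𝓝 (∫ x, fderiv ℝ ζ x v * k x)) := by
  obtain ⟨D, hD⟩ := ContDiff.lipschitzWith_of_hasCompactSupport hc hζ (by simp)
  have h := hD.integral_inv_smul_sub_mul_tendsto_integral_lineDeriv_mul' (μ := volume) hc hk v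
  simpa only [((hζ.differentiable (by simp)) _).lineDeriv_eq_fderiv] using h

lemma vr_cont_fd {F : Type*} [NormedAddCommGroup F] [NormedSpace ℝ F] {a : Euc 2 → F}
    (ha : ContDiff ℝ 1 a) (v : Euc 2) : Continuous fun x => fderiv ℝ a x v :=
  (ha.continuous_fderiv (by simp)).clm_apply continuous_const

lemma vr_ibp {a b : Euc 2 → ℝ} (ha : ContDiff ℝ 1 a) (hb : ContDiff ℝ 1 b)
    (hca : HasCompactSupport a) (v : Euc 2) :
    ∫ x, b x * fderiv ℝ a x v = - ∫ x, fderiv ℝ b x v * a x := by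
  have h1 := vr_cont_fd ha v
  have h2 := vr_cont_fd hb v
  apply integral_mul_fderiv_eq_neg_fderiv_mul_of_integrable
  · exact (h2.mul ha.continuous).integrable_of_hasCompactSupport hca.mul_left
  · exact (hb.continuous.mul h1).integrable_of_hasCompactSupport
      (hca.fderiv_apply (𝕜 := ℝ) v).mul_left
  · exact (hb.continuous.mul ha.continuous).integrable_of_hasCompactSupport hca.mul_left
  · exact fun x _ => hb.differentiable (by simp) x
  · exact fun x _ => ha.differentiable (by simp) x

lemma vr_null_cc {a b : Euc 2 → ℝ} (ha : ContDiff ℝ 1 a) (hca : HasCompactSupport a)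
    (hb : ContDiff ℝ 1 b) (hcb : HasCompactSupport b) (v w : Euc 2) :
    ∫ x, fderiv ℝ a x v * fderiv ℝ b x w = ∫ x, fderiv ℝ a x w * fderiv ℝ b x v := by
  have T1 := vr_dq hb hcb (vr_cont_fd ha v) w
  have T2 := (vr_dq ha hca (vr_cont_fd hb v) (-w)).neg
  have E : ∀ t : ℝ, ∫ x, (t⁻¹ • (b (x + t • w) - b x)) * fderiv ℝ a x v
      = - ∫ x, (t⁻¹ • (a (x + t • (-w)) - a x)) * fderiv ℝ b x v := by
    intro t
    have hb' : ContDiff ℝ 1 (fun x => b (x + t • w)) := hb.comp (by fun_prop)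
    have ha' : ContDiff ℝ 1 (fun x => a (x + t • (-w))) := ha.comp (by fun_prop)
    have i1 := vr_ibp ha hb' hca v
    have i2 := vr_ibp ha hb hca v
    have e1 : ∫ x, fderiv ℝ (fun x => b (x + t • w)) x v * a x
        = ∫ x, fderiv ℝ b x v * a (x + t • (-w)) := by
      rw [← integral_add_right_eq_self (fun x => fderiv ℝ b x v * a (x + t • (-w))) (t • w)]
      refine integral_congr_ae (Eventually.of_forall fun x => ?_)
      simp only [fderiv_comp_add_right]
      congr 2
      simp
    rw [e1] at i1
    have hda := vr_cont_fd ha v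
    have hdb := vr_cont_fd hb v
    have I1 : Integrable fun x => b (x + t • w) * fderiv ℝ a x v :=
      (hb'.continuous.mul hda).integrable_of_hasCompactSupport
        (hca.fderiv_apply (𝕜 := ℝ) v).mul_left
    have I2 : Integrable fun x => b x * fderiv ℝ a x v :=
      (hb.continuous.mul hda).integrable_of_hasCompactSupport
        (hca.fderiv_apply (𝕜 := ℝ) v).mul_left
    have I3 : Integrable fun x => fderiv ℝ b x v * a (x + t • (-w)) :=
      (hdb.mul ha'.continuous).integrable_of_hasCompactSupport
        (hcb.fderiv_apply (𝕜 := ℝ) v).mul_right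
    have I4 : Integrable fun x => fderiv ℝ b x v * a x :=
      (hdb.mul ha.continuous).integrable_of_hasCompactSupport hca.mul_left
    have L : ∫ x, (t⁻¹ • (b (x + t • w) - b x)) * fderiv ℝ a x v
        = t⁻¹ * ((∫ x, b (x + t • w) * fderiv ℝ a x v) - ∫ x, b x * fderiv ℝ a x v) := by
      rw [← integral_sub I1 I2, ← integral_const_mul]
      refine integral_congr_ae (Eventually.of_forall fun x => ?_)
      simp only [smul_eq_mul]; ring
    have R : ∫ x, (t⁻¹ • (a (x + t • (-w)) - a x)) * fderiv ℝ b x v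
        = t⁻¹ * ((∫ x, fderiv ℝ b x v * a (x + t • (-w))) - ∫ x, fderiv ℝ b x v * a x) := by
      rw [← integral_sub I3 I4, ← integral_const_mul]
      refine integral_congr_ae (Eventually.of_forall fun x => ?_)
      simp only [smul_eq_mul]; ring
    rw [L, R, i1, i2]; ring
  simp only [← E] at T2
  have := tendsto_nhds_unique T1 T2
  simp only [map_neg, neg_mul, integral_neg, neg_neg] at this
  rw [← this]
  refine integral_congr_ae (Eventually.of_forall fun x => mul_comm _ _)

lemma vr_cutoff {K U : Set (Euc 2)} (hK : IsCompact K) (hU : IsOpen U) (hKU : K ⊆ U) :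
    ∃ η : Euc 2 → ℝ, ContDiff ℝ 1 η ∧ HasCompactSupport η ∧ tsupport η ⊆ U ∧
      (∀ᶠ x in 𝓝ˢ K, η x = 1) ∧ ∀ x, η x ∈ Icc (0:ℝ) 1 := by
  obtain ⟨L, hL, hKL, hLU⟩ := exists_compact_between hK hU hKU
  obtain ⟨f, h1, h2, h3⟩ := exists_contMDiffMap_one_nhds_of_subset_interior (n := (1 : ℕ∞))
    (modelWithCornersSelf ℝ (Euc 2)) hK.isClosed hKL
  have hs : tsupport f ⊆ L := by
    apply closure_minimal _ hL.isClosed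
    intro x hx
    by_contra hxL
    exact hx (h2 x hxL)
  refine ⟨f, ?_, hL.of_isClosed_subset (isClosed_tsupport _) hs, hs.trans hLU, h1, h3⟩
  exact f.contMDiff.contDiff

lemma vr_null {a b : Euc 2 → ℝ} {U : Set (Euc 2)} (hU : IsOpen U)
    (ha : ContDiff ℝ 1 a) (hca : HasCompactSupport a) (haU : tsupport a ⊆ U)
    (hb : ContDiffOn ℝ 1 b U) (v w : Euc 2) :
    ∫ x, fderiv ℝ a x v * fderiv ℝ b x w = ∫ x, fderiv ℝ a x w * fderiv ℝ b x v := by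
  obtain ⟨η, hη, hηc, hηU, h1, -⟩ := vr_cutoff hca.isCompact hU haU
  have hb' : ContDiff ℝ 1 (fun x => η x * b x) := by
    rw [contDiff_iff_contDiffAt]
    intro x
    by_cases hx : x ∈ U
    · exact hη.contDiffAt.mul (hb.contDiffAt (hU.mem_nhds hx))
    · have : ∀ᶠ y in 𝓝 x, η y = 0 :=
        notMem_tsupport_iff_eventuallyEq.1 (fun h => hx (hηU h))
      refine contDiffAt_const (c := (0:ℝ)) |>.congr_of_eventuallyEq ?_
      filter_upwards [this] with y hy
      simp [hy]
  have hcb' : HasCompactSupport (fun x => η x * b x) := hηc.mul_right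
  have key := vr_null_cc ha hca hb' hcb' v w
  have e : ∀ v w x, fderiv ℝ a x v * fderiv ℝ (fun x => η x * b x) x w
      = fderiv ℝ a x v * fderiv ℝ b x w := by
    intro v w x
    by_cases hx : x ∈ tsupport a
    · have : ∀ᶠ y in 𝓝 x, η y = 1 := by
        rw [eventually_nhdsSet_iff_forall] at h1
        exact h1 x hx
      have h2 : (fun x => η x * b x) =ᶠ[𝓝 x] b := by
        filter_upwards [this] with y hy
        simp [hy]
      rw [h2.fderiv_eq]
    · have h0 : fderiv ℝ a x = 0 := by
        have : a =ᶠ[𝓝 x] 0 := notMem_tsupport_iff_eventuallyEq.1 hx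
        rw [this.fderiv_eq]; simp
      simp [h0]
  simpa only [e] using key

/-- Jacobian determinant in coordinates -/
def jdet (M : Euc 2 →L[ℝ] Euc 2) : ℝ := M (ee 0) 0 * M (ee 1) 1 - M (ee 0) 1 * M (ee 1) 0

lemma vr_tJac_apply (φ : Euc 2 → Euc 2) (x v : Euc 2) (i : Fin 2) :
    tJac φ x v i = ∑ k, v k * fderiv ℝ φ x (ee i) k := by
  have h : inner ℝ (tJac φ x v) (ee i) = tJac φ x v i := by
    simp [ee, EuclideanSpace.inner_single_right]
  rw [← h, tJac, ContinuousLinearMap.adjoint_inner_left, PiLp.inner_apply]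
  simp [mul_comm]

lemma vr_expand (v : Euc 2) : v = v 0 • ee 0 + v 1 • ee 1 := by
  ext i; fin_cases i <;> simp [ee]

lemma vr_weak_curl {φ v : Euc 2 → Euc 2} {ψ : Euc 2 → ℝ} (hφ : ContDiff ℝ 1 φ)
    (hv : ContDiff ℝ 1 v) (hψ : ContDiff ℝ 1 ψ) (hc : HasCompactSupport ψ) :
    ∫ x, (fderiv ℝ ψ x (ee 0) * tJac φ x (v (φ x)) 1
        - fderiv ℝ ψ x (ee 1) * tJac φ x (v (φ x)) 0)
      = - ∫ x, ψ x * (jdet (fderiv ℝ φ x) * curl2 v (φ x)) := by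
  have cφ : ∀ k : Fin 2, ContDiff ℝ 1 (fun x => φ x k) := fun k => by
    exact (contDiff_euclidean.1 hφ) k
  have cv : ∀ k : Fin 2, ContDiff ℝ 1 (fun x => v x k) := fun k => by
    exact (contDiff_euclidean.1 hv) k
  have ca : ∀ k : Fin 2, ContDiff ℝ 1 (fun x => ψ x * v (φ x) k) := fun k =>
    hψ.mul ((cv k).comp hφ)
  have hsup : ∀ k : Fin 2, HasCompactSupport (fun x => ψ x * v (φ x) k) := fun k => hc.mul_right
  have N : ∀ k : Fin 2, ∫ x, (fderiv ℝ (fun x => ψ x * v (φ x) k) x (ee 0)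
        * fderiv ℝ (fun x => φ x k) x (ee 1)
      - fderiv ℝ (fun x => ψ x * v (φ x) k) x (ee 1)
        * fderiv ℝ (fun x => φ x k) x (ee 0)) = 0 := by
    intro k
    rw [integral_sub, vr_null isOpen_univ (ca k) (hsup k) (subset_univ _) (cφ k).contDiffOn, sub_self]
    · exact ((vr_cont_fd (ca k) _).mul (vr_cont_fd (cφ k) _)).integrable_of_hasCompactSupport
        ((hsup k).fderiv_apply (𝕜 := ℝ) _).mul_right
    · exact ((vr_cont_fd (ca k) _).mul (vr_cont_fd (cφ k) _)).integrable_of_hasCompactSupport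
        ((hsup k).fderiv_apply (𝕜 := ℝ) _).mul_right
  have dφ : ∀ (k : Fin 2) x w, fderiv ℝ (fun x => φ x k) x w = fderiv ℝ φ x w k := by
    intro k x w
    have := ((EuclideanSpace.proj (𝕜 := ℝ) k).hasFDerivAt.comp x
      (hφ.differentiable (by simp) x).hasFDerivAt)
    have h2 := this.fderiv
    exact congrArg (fun L => L w) h2
  have dv : ∀ (k : Fin 2) x w, fderiv ℝ (fun x => v x k) x w = fderiv ℝ v x w k := by
    intro k x w
    have := ((EuclideanSpace.proj (𝕜 := ℝ) k).hasFDerivAt.comp x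
      (hv.differentiable (by simp) x).hasFDerivAt)
    have h2 := this.fderiv
    exact congrArg (fun L => L w) h2
  have da : ∀ (k : Fin 2) x w, fderiv ℝ (fun x => ψ x * v (φ x) k) x w
      = fderiv ℝ ψ x w * v (φ x) k + ψ x * fderiv ℝ v (φ x) (fderiv ℝ φ x w) k := by
    intro k x w
    have h1 := (hψ.differentiable (by simp) x).hasFDerivAt
    have h2 : HasFDerivAt (fun x => v (φ x) k) _ x :=
      (((cv k).differentiable (by simp) (φ x)).hasFDerivAt.comp x
      (hφ.differentiable (by simp) x).hasFDerivAt)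
    rw [(h1.fun_mul h2).fderiv]
    simp [dv]
    ring
  have cdφ : ∀ (i k : Fin 2), Continuous fun x => fderiv ℝ φ x (ee i) k := by
    intro i k
    have := vr_cont_fd (cφ k) (ee i)
    simpa only [dφ] using this
  have cF : ∀ i : Fin 2, Continuous fun x => tJac φ x (v (φ x)) i := by
    intro i
    simp only [vr_tJac_apply]
    refine continuous_finsetSum _ fun k _ => ?_
    exact ((cv k).continuous.comp hφ.continuous).mul (cdφ i k)
  have cJ : Continuous fun x => jdet (fderiv ℝ φ x) := by
    unfold jdet
    exact ((cdφ _ _).mul (cdφ _ _)).sub ((cdφ _ _).mul (cdφ _ _))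
  have cC : Continuous fun x => curl2 v (φ x) := by
    have : Continuous (curl2 v) := by
      unfold curl2
      simp only [← dv]
      exact (vr_cont_fd (cv 1) _).sub (vr_cont_fd (cv 0) _)
    exact this.comp hφ.continuous
  have I1 : Integrable fun x => (fderiv ℝ ψ x (ee 0) * tJac φ x (v (φ x)) 1
        - fderiv ℝ ψ x (ee 1) * tJac φ x (v (φ x)) 0) :=
    (((vr_cont_fd hψ _).mul (cF 1)).integrable_of_hasCompactSupport
      (hc.fderiv_apply (𝕜 := ℝ) _).mul_right).sub
    (((vr_cont_fd hψ _).mul (cF 0)).integrable_of_hasCompactSupport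
      (hc.fderiv_apply (𝕜 := ℝ) _).mul_right)
  have I2 : Integrable fun x => ψ x * (jdet (fderiv ℝ φ x) * curl2 v (φ x)) :=
    (hψ.continuous.mul (cJ.mul cC)).integrable_of_hasCompactSupport hc.mul_right
  have S : ∫ x, ((fderiv ℝ ψ x (ee 0) * tJac φ x (v (φ x)) 1
        - fderiv ℝ ψ x (ee 1) * tJac φ x (v (φ x)) 0)
        + ψ x * (jdet (fderiv ℝ φ x) * curl2 v (φ x))) = 0 := by
    have J : ∀ k : Fin 2, Integrable fun x => (fderiv ℝ (fun x => ψ x * v (φ x) k) x (ee 0)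
        * fderiv ℝ (fun x => φ x k) x (ee 1)
      - fderiv ℝ (fun x => ψ x * v (φ x) k) x (ee 1)
        * fderiv ℝ (fun x => φ x k) x (ee 0)) := fun k =>
      (((vr_cont_fd (ca k) _).mul (vr_cont_fd (cφ k) _)).integrable_of_hasCompactSupport
        ((hsup k).fderiv_apply (𝕜 := ℝ) _).mul_right).sub
      (((vr_cont_fd (ca k) _).mul (vr_cont_fd (cφ k) _)).integrable_of_hasCompactSupport
        ((hsup k).fderiv_apply (𝕜 := ℝ) _).mul_right)
    have := integral_add (J 0) (J 1)
    rw [N 0, N 1, add_zero] at this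
    rw [← this]
    refine integral_congr_ae (Eventually.of_forall fun x => ?_)
    simp only [da, dφ, vr_tJac_apply, Fin.sum_univ_two, jdet, curl2]
    set A := fderiv ℝ φ x
    set B := fderiv ℝ v (φ x)
    have hB : ∀ w k, B w k = w 0 * B (ee 0) k + w 1 * B (ee 1) k := by
      intro w k
      conv_lhs => rw [vr_expand w]
      simp
    rw [hB (A (ee 0)) 0, hB (A (ee 0)) 1, hB (A (ee 1)) 0, hB (A (ee 1)) 1]
    ring
  rw [integral_add I1 I2] at S
  linarith

/-! ## Part 3 -/
/-- the weak curl functional -/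
def wcurl (g : Euc 2 → Euc 2) (ψ : Euc 2 → ℝ) : ℝ :=
  ∫ x, (fderiv ℝ ψ x (ee 0) * g x 1 - fderiv ℝ ψ x (ee 1) * g x 0)

lemma vr_coord_cont {g : Euc 2 → Euc 2} (hg : Continuous g) (i : Fin 2) :
    Continuous fun x => g x i := (EuclideanSpace.proj (𝕜 := ℝ) i).continuous.comp hg

lemma vr_int_fd {k ψ : Euc 2 → ℝ} (hk : Continuous k) (hψ : ContDiff ℝ 1 ψ)
    (hc : HasCompactSupport ψ) (v : Euc 2) : Integrable fun x => fderiv ℝ ψ x v * k x :=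
  ((vr_cont_fd hψ _).mul hk).integrable_of_hasCompactSupport
      (hc.fderiv_apply (𝕜 := ℝ) _).mul_right

lemma wcurl_eq {g : Euc 2 → Euc 2} (hg : Continuous g) {ψ : Euc 2 → ℝ} (hψ : ContDiff ℝ 1 ψ)
    (hc : HasCompactSupport ψ) : wcurl g ψ =
      (∫ x, fderiv ℝ ψ x (ee 0) * g x 1) - ∫ x, fderiv ℝ ψ x (ee 1) * g x 0 := by
  rw [wcurl, integral_sub (vr_int_fd (vr_coord_cont hg 1) hψ hc _)
    (vr_int_fd (vr_coord_cont hg 0) hψ hc _)]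

lemma vr_grad_local {g : Euc 2 → Euc 2} (hg : Continuous g) {q : Euc 2 → ℝ}
    (hq : ∀ x, g x = gradient q x) {ζ : Euc 2 → ℝ} (hζ : ContDiff ℝ 1 ζ)
    (hc : HasCompactSupport ζ) (hs : tsupport ζ ⊆ {x | g x ≠ 0}) : wcurl g ζ = 0 := by
  have hU : IsOpen {x | g x ≠ 0} := isOpen_ne_fun hg continuous_const
  have hfd : ∀ x, fderiv ℝ q x = InnerProductSpace.toDual ℝ (Euc 2) (g x) := by
    intro x; rw [hq x, gradient]; simp
  have hco : ∀ x i, fderiv ℝ q x (ee i) = g x i := by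
    intro x i
    rw [hfd]
    simp [ee, EuclideanSpace.inner_single_right]
  have hC : ContDiffOn ℝ 1 q {x | g x ≠ 0} := by
    have := (contDiffOn_succ_iff_fderiv_of_isOpen (𝕜 := ℝ) (n := 0) (f := q) hU).2 ⟨?_, ?_, ?_⟩
    · simpa using this
    · intro x hx
      by_contra hnd
      have : fderiv ℝ q x = 0 := fderiv_zero_of_not_differentiableAt
        (fun h => hnd h.differentiableWithinAt)
      apply hx
      rw [hq x, gradient, this]; simp
    · intro h; simp at h
    · rw [contDiffOn_zero]
      have : Continuous (fderiv ℝ q) := by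
        have e : fderiv ℝ q = fun x => InnerProductSpace.toDual ℝ (Euc 2) (g x) := funext hfd
        rw [e]
        exact (InnerProductSpace.toDual ℝ (Euc 2)).continuous.comp hg
      exact this.continuousOn
  have := vr_null hU hζ hc hs hC (ee 0) (ee 1)
  simp only [hco] at this
  rw [wcurl_eq hg hζ hc, this, sub_self]

lemma vr_meas_shift {K : Set (Euc 2)} (hK : IsCompact K) (v : Euc 2) :
    Tendsto (fun t : ℝ => volume (K \ (fun x => x + t • v) ⁻¹' K)) (𝓝[>] 0) (𝓝 0) := by
  have h := tendsto_measure_vadd_sdiff_isCompact_isClosed (μ := (volume : Measure (Euc 2)))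
    hK hK.isClosed
  have h2 : Tendsto (fun t : ℝ => t • v) (𝓝[>] 0) (𝓝 0) := by
    have : Continuous fun t : ℝ => t • v := by fun_prop
    simpa using (this.tendsto 0).mono_left nhdsWithin_le_nhds
  refine (h.comp h2).congr fun t => ?_
  simp only [Function.comp]
  rw [← measure_preimage_add_right volume (t • v)]
  congr 1
  ext x
  simp [Set.mem_vadd_set_iff_neg_vadd_mem]

/-- one-directional difference quotient bound -/
lemma vr_dq_bound {g : Euc 2 → Euc 2} (hg : Continuous g) {m : ℝ≥0∞ → ℝ≥0∞}
    (hm : Tendsto m (𝓝 0) (𝓝 0)) (v : Euc 2)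
    (hd : ∀ A : Set (Euc 2), MeasurableSet A → ∀ t ∈ Ioc (0:ℝ) 1,
      ∫⁻ x in A, ‖g (x + t • v) - g x‖ₑ ≤ ENNReal.ofReal t * m (volume A))
    {S : Set (Euc 2)} (hS : IsCompact S) (ε : ℝ) {M : ℝ≥0} {θ : Euc 2 → ℝ} (hθ : ContDiff ℝ 1 θ)
    (hc : HasCompactSupport θ) (hM : ∀ x, ‖θ x‖ₑ ≤ M) (hθS : ∀ x ∉ S, θ x = 0)
    (hθK : ∀ x ∈ S, ε ≤ ‖g x‖ → θ x = 0) (i : Fin 2) :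
    ‖∫ x, fderiv ℝ θ x v * g x i‖ₑ ≤ M * m (volume (S ∩ {x | 0 < ‖g x‖ ∧ ‖g x‖ < ε})) := by
  set Aε : Set (Euc 2) := S ∩ {x | 0 < ‖g x‖ ∧ ‖g x‖ < ε} with hAε
  have hAm : MeasurableSet Aε := by
    refine hS.measurableSet.inter ?_
    exact ((isOpen_lt continuous_const hg.norm).inter
      (isOpen_lt hg.norm continuous_const)).measurableSet
  set Z : Set (Euc 2) := S ∩ {x | g x = 0} with hZ
  have hZc : IsCompact Z := hS.inter_right (isClosed_eq hg continuous_const)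
  have hgi := vr_coord_cont hg i
  have T := (vr_dq hθ hc hgi (-v)).enorm
  have hlim : Tendsto (fun t : ℝ => (M:ℝ≥0∞) * (m (volume (Z \ (fun x => x + t • v) ⁻¹' Z))
      + m (volume Aε))) (𝓝[>] 0) (𝓝 (M * (0 + m (volume Aε)))) := by
    refine ENNReal.Tendsto.const_mul ?_ (Or.inr ENNReal.coe_ne_top)
    exact (hm.comp (vr_meas_shift hZc v)).add tendsto_const_nhds
  rw [zero_add] at hlim
  have e0 : ‖∫ x, fderiv ℝ θ x (-v) * g x i‖ₑ = ‖∫ x, fderiv ℝ θ x v * g x i‖ₑ := by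
    simp only [map_neg, neg_mul, integral_neg, enorm_neg]
  rw [e0] at T
  refine le_of_tendsto_of_tendsto T hlim ?_
  have hev : ∀ᶠ t : ℝ in 𝓝[>] 0, t ∈ Ioc (0:ℝ) 1 := Ioc_mem_nhdsGT one_pos
  filter_upwards [hev] with t ht
  have eq1 : ∫ x, (t⁻¹ • (θ (x + t • (-v)) - θ x)) * g x i
      = ∫ x, t⁻¹ * (θ x * (g (x + t • v) i - g x i)) := by
    have cθ' : Continuous fun x => θ (x + t • (-v)) := hθ.continuous.comp (by fun_prop)
    have cs' : HasCompactSupport fun x => θ (x + t • (-v)) := by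
      exact hc.comp_homeomorph (Homeomorph.addRight (t • (-v)))
    have cg' : Continuous fun x => g (x + t • v) i := hgi.comp (by fun_prop)
    have I1 : Integrable fun x => θ (x + t • (-v)) * g x i :=
      (cθ'.mul hgi).integrable_of_hasCompactSupport cs'.mul_right
    have I2 : Integrable fun x => θ x * g x i :=
      (hθ.continuous.mul hgi).integrable_of_hasCompactSupport hc.mul_right
    have I3 : Integrable fun x => θ x * g (x + t • v) i :=
      (hθ.continuous.mul cg').integrable_of_hasCompactSupport hc.mul_right
    have s : ∫ x, θ (x + t • (-v)) * g x i = ∫ x, θ x * g (x + t • v) i := by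
      rw [← integral_add_right_eq_self (fun x => θ (x + t • (-v)) * g x i) (t • v)]
      simp
    calc _ = ∫ x, t⁻¹ * (θ (x + t • (-v)) * g x i - θ x * g x i) := by
            congr 1; ext x; simp only [smul_eq_mul]; ring
      _ = ∫ x, t⁻¹ * (θ x * g (x + t • v) i - θ x * g x i) := by
            rw [integral_const_mul, integral_const_mul, integral_sub I1 I2, integral_sub I3 I2, s]
      _ = _ := by congr 1; ext x; ring
  rw [eq1]
  have hsplit : ∀ x, ‖t⁻¹ * (θ x * (g (x + t • v) i - g x i))‖ₑ ≤
      ENNReal.ofReal t⁻¹ * M * ((Z \ (fun x => x + t • v) ⁻¹' Z ∪ Aε).indicator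
        (fun x => ‖g (x + t • v) - g x‖ₑ) x) := by
    intro x
    by_cases hx : θ x = 0
    · simp [hx]
    have hxS : x ∈ S := by by_contra h; exact hx (hθS x h)
    have hlt : ‖g x‖ < ε := by by_contra! h; exact hx (hθK x hxS h)
    have co : ‖g (x + t • v) i - g x i‖ₑ ≤ ‖g (x + t • v) - g x‖ₑ := by
      rw [← ofReal_norm, ← ofReal_norm]
      apply ENNReal.ofReal_le_ofReal
      exact PiLp.norm_apply_le (g (x + t • v) - g x) i
    have base : ‖t⁻¹ * (θ x * (g (x + t • v) i - g x i))‖ₑ ≤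
        ENNReal.ofReal t⁻¹ * M * ‖g (x + t • v) - g x‖ₑ := by
      rw [enorm_mul, enorm_mul, ← mul_assoc,
        Real.enorm_of_nonneg (inv_nonneg.2 ht.1.le)]
      gcongr
      exact hM x
    by_cases hxm : x ∈ (Z \ (fun x => x + t • v) ⁻¹' Z ∪ Aε)
    · rw [indicator_of_mem hxm]; exact base
    · refine base.trans ?_
      have hgx : g x = 0 := by
        by_contra h
        exact hxm (Or.inr ⟨hxS, norm_pos_iff.2 h, hlt⟩)
      have hgx2 : g (x + t • v) = 0 := by
        by_contra h
        exact hxm (Or.inl ⟨⟨hxS, hgx⟩, fun h' => h h'.2⟩)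
      simp [hgx, hgx2]
  have hmZ : MeasurableSet (Z \ (fun x => x + t • v) ⁻¹' Z) :=
    hZc.measurableSet.diff (hZc.isClosed.preimage (by fun_prop)).measurableSet
  have hmeas : Measurable fun x => ‖g (x + t • v) - g x‖ₑ :=
    ((hg.comp (by fun_prop : Continuous fun x : Euc 2 => x + t • v)).sub hg).enorm.measurable
  calc ‖∫ x, t⁻¹ * (θ x * (g (x + t • v) i - g x i))‖ₑ
      ≤ ∫⁻ x, ‖t⁻¹ * (θ x * (g (x + t • v) i - g x i))‖ₑ := enorm_integral_le_lintegral_enorm _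
    _ ≤ ∫⁻ x, ENNReal.ofReal t⁻¹ * M * ((Z \ (fun x => x + t • v) ⁻¹' Z ∪ Aε).indicator
        (fun x => ‖g (x + t • v) - g x‖ₑ) x) := lintegral_mono hsplit
    _ = ENNReal.ofReal t⁻¹ * M * ∫⁻ x in (Z \ (fun x => x + t • v) ⁻¹' Z ∪ Aε),
        ‖g (x + t • v) - g x‖ₑ := by
      rw [lintegral_const_mul _ (hmeas.indicator (hmZ.union hAm)),
        lintegral_indicator (hmZ.union hAm)]
    _ ≤ ENNReal.ofReal t⁻¹ * M * (ENNReal.ofReal t * m (volume (Z \ (fun x => x + t • v) ⁻¹' Z))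
        + ENNReal.ofReal t * m (volume Aε)) := by
      gcongr
      refine (lintegral_union_le _ _ _).trans ?_
      gcongr
      · exact hd _ hmZ t ht
      · exact hd _ hAm t ht
    _ = (ENNReal.ofReal t⁻¹ * ENNReal.ofReal t) * (M * (m (volume (Z \ (fun x => x + t • v) ⁻¹' Z))
      + m (volume Aε))) := by ring
    _ = _ := by
      rw [← ENNReal.ofReal_mul (inv_nonneg.2 ht.1.le), inv_mul_cancel₀ ht.1.ne', ENNReal.ofReal_one,
        one_mul]

lemma vr_gradient_wcurl {g : Euc 2 → Euc 2} (hg : Continuous g) {m : ℝ≥0∞ → ℝ≥0∞}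
    (hm : Tendsto m (𝓝 0) (𝓝 0))
    (hd : ∀ A : Set (Euc 2), MeasurableSet A → ∀ t ∈ Ioc (0:ℝ) 1, ∀ i : Fin 2,
      ∫⁻ x in A, ‖g (x + t • ee i) - g x‖ₑ ≤ ENNReal.ofReal t * m (volume A))
    {q : Euc 2 → ℝ} (hq : ∀ x, g x = gradient q x) {ψ : Euc 2 → ℝ} (hψ : ContDiff ℝ 1 ψ)
    (hc : HasCompactSupport ψ) : wcurl g ψ = 0 := by
  obtain ⟨M, hM⟩ := hc.exists_bound_of_continuous hψ.continuous
  set S := tsupport ψ with hS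
  have hSc : IsCompact S := hc
  have hU : IsOpen {x | g x ≠ 0} := isOpen_ne_fun hg continuous_const
  have main : ∀ n : ℕ, ‖wcurl g ψ‖ₑ ≤ 2 * (M.toNNReal *
      m (volume (S ∩ {x | 0 < ‖g x‖ ∧ ‖g x‖ < 1 / ((n:ℝ) + 1)}))) := by
    intro n
    set ε : ℝ := 1 / ((n:ℝ) + 1) with hε
    have hεpos : 0 < ε := by positivity
    have hK : IsCompact (S ∩ {x | ε ≤ ‖g x‖}) :=
      hSc.inter_right (isClosed_le continuous_const hg.norm)
    have hKU : S ∩ {x | ε ≤ ‖g x‖} ⊆ {x | g x ≠ 0} := fun x hx =>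
      norm_pos_iff.1 (hεpos.trans_le hx.2)
    obtain ⟨η, hη, hηc, hηU, h1, h01⟩ := vr_cutoff hK hU hKU
    have c1 : ContDiff ℝ 1 (fun x => η x * ψ x) := hη.mul hψ
    have s1 : HasCompactSupport (fun x => η x * ψ x) := hηc.mul_right
    have c2 : ContDiff ℝ 1 (fun x => (1 - η x) * ψ x) := (contDiff_const.sub hη).mul hψ
    have s2 : HasCompactSupport (fun x => (1 - η x) * ψ x) := hc.mul_left
    have z1 : wcurl g (fun x => η x * ψ x) = 0 := by
      refine vr_grad_local hg hq c1 s1 (Set.Subset.trans ?_ hηU)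
      exact closure_mono (fun x hx => left_ne_zero_of_mul hx)
    have sum : wcurl g ψ = wcurl g (fun x => (1 - η x) * ψ x) := by
      have fd : ∀ x v, fderiv ℝ ψ x v = fderiv ℝ (fun x => η x * ψ x) x v
          + fderiv ℝ (fun x => (1 - η x) * ψ x) x v := by
        intro x v
        have := ((c1.differentiable (by simp) x).hasFDerivAt.add
          (c2.differentiable (by simp) x).hasFDerivAt).fderiv
        have e : (fun x => η x * ψ x) + (fun x => (1 - η x) * ψ x) = ψ := by
          ext x; simp only [Pi.add_apply]; ring
        rw [e] at this
        rw [this]; rfl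
      rw [wcurl_eq hg c1 s1] at z1
      rw [wcurl_eq hg hψ hc, wcurl_eq hg c2 s2]
      simp only [fd, add_mul]
      rw [integral_add (vr_int_fd (vr_coord_cont hg 1) c1 s1 _)
        (vr_int_fd (vr_coord_cont hg 1) c2 s2 _), integral_add
        (vr_int_fd (vr_coord_cont hg 0) c1 s1 _) (vr_int_fd (vr_coord_cont hg 0) c2 s2 _)]
      linarith
    have bM : ∀ x, ‖(1 - η x) * ψ x‖ₑ ≤ M.toNNReal := by
      intro x
      rw [← ofReal_norm]
      change _ ≤ ENNReal.ofReal M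
      apply ENNReal.ofReal_le_ofReal
      rw [norm_mul]
      have : ‖1 - η x‖ ≤ 1 := by
        rw [Real.norm_eq_abs, abs_le]; constructor <;> linarith [(h01 x).1, (h01 x).2]
      calc _ ≤ 1 * ‖ψ x‖ := by gcongr
        _ ≤ M := by rw [one_mul]; exact hM x
    have b0 : ∀ x ∉ S, (1 - η x) * ψ x = 0 := fun x hx => by
      rw [image_eq_zero_of_notMem_tsupport hx, mul_zero]
    have bK : ∀ x ∈ S, ε ≤ ‖g x‖ → (1 - η x) * ψ x = 0 := fun x hx hx2 => by
      have := h1.self_of_nhdsSet x ⟨hx, hx2⟩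
      rw [this]; simp
    have B : ∀ i j : Fin 2, _ := fun i j => vr_dq_bound hg hm (ee j)
      (fun A hA t ht => hd A hA t ht j) hSc ε c2 s2 bM b0 bK i
    rw [sum, wcurl_eq hg c2 s2, two_mul]
    refine (enorm_sub_le).trans (add_le_add (B 1 0) (B 0 1))
  have lim : Tendsto (fun n : ℕ => 2 * ((M.toNNReal : ℝ≥0∞) *
      m (volume (S ∩ {x | 0 < ‖g x‖ ∧ ‖g x‖ < 1 / ((n:ℝ) + 1)})))) atTop (𝓝 (2 * (M.toNNReal * 0))) := by
    refine ENNReal.Tendsto.const_mul (ENNReal.Tendsto.const_mul (hm.comp ?_)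
      (Or.inr ENNReal.coe_ne_top)) (Or.inr (by simp))
    have := tendsto_measure_iInter_atTop (μ := (volume : Measure (Euc 2)))
      (s := fun n : ℕ => S ∩ {x | 0 < ‖g x‖ ∧ ‖g x‖ < 1 / ((n:ℝ) + 1)}) ?_ ?_ ?_
    · have e : ⋂ n : ℕ, S ∩ {x | 0 < ‖g x‖ ∧ ‖g x‖ < 1 / ((n:ℝ) + 1)} = ∅ := by
        ext x
        simp only [mem_iInter, mem_inter_iff, mem_setOf_eq, mem_empty_iff_false, iff_false, not_forall]
        by_contra! h
        obtain ⟨n, hn⟩ := exists_nat_one_div_lt (h 0).2.1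
        exact absurd (h n).2.2 (not_lt.2 hn.le)
      rwa [e, measure_empty] at this
    · intro n
      exact (hSc.measurableSet.inter ((isOpen_lt continuous_const hg.norm).inter
        (isOpen_lt hg.norm continuous_const)).measurableSet).nullMeasurableSet
    · intro a b hab x hx
      refine ⟨hx.1, hx.2.1, hx.2.2.trans_le ?_⟩
      have : (a:ℝ) ≤ b := by exact_mod_cast hab
      gcongr
    · exact ⟨0, ((measure_mono inter_subset_left).trans_lt hSc.measure_lt_top).ne⟩
  have := ge_of_tendsto' lim main
  simpa using this

/-! ## Part 4 -/
lemma vr_gronwall {y : ℝ → ℝ} (hy : Continuous y) (hy0 : ∀ s, 0 ≤ y s) {δ K a c : ℝ} (hδ : 0 ≤ δ)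
    (hK : 0 ≤ K) (h : ∀ s ∈ Icc a c, y s ≤ δ + K * ∫ r in a..s, y r) :
    ∀ s ∈ Icc a c, y s ≤ δ * Real.exp (K * (s - a)) := by
  intro s hs
  have hG : ∀ s, HasDerivAt (fun s => δ + K * ∫ r in a..s, y r) (K * y s) s := fun s =>
    ((intervalIntegral.integral_hasDerivAt_right (hy.intervalIntegrable _ _)
      (hy.stronglyMeasurableAtFilter _ _) hy.continuousAt).const_mul K).const_add δ
  have hnn : ∀ s ∈ Icc a c, 0 ≤ δ + K * ∫ r in a..s, y r := fun s hs =>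
    (hy0 s).trans (h s hs)
  have := norm_le_gronwallBound_of_norm_deriv_right_le (f := fun s => δ + K * ∫ r in a..s, y r)
    (f' := fun s => K * y s) (δ := δ) (K := K) (ε := 0) (a := a) (b := c)
    (fun s hs => (hG s).continuousAt.continuousWithinAt) (fun s hs => (hG s).hasDerivWithinAt)
    (by simp [abs_of_nonneg hδ])
    (fun s hs => by
      have hs' := Ico_subset_Icc_self hs
      rw [Real.norm_of_nonneg (mul_nonneg hK (hy0 s)), Real.norm_of_nonneg (hnn s hs'), add_zero]
      exact mul_le_mul_of_nonneg_left (h s hs') hK) s hs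
  rw [gronwallBound_ε0] at this
  exact (h s hs).trans ((le_abs_self _).trans this)

section picard
set_option linter.unusedSectionVars false
variable {E : Type*} [NormedAddCommGroup E] [NormedSpace ℝ E] [CompleteSpace E]

/-- Picard iterates. -/
def pic (F : ℝ → E → E) (a : ℝ) (x : E) : ℕ → ℝ → E
  | 0 => fun _ => x
  | n + 1 => fun s => x + ∫ r in a..s, F r (pic F a x n r)

lemma pic_cont {F : ℝ → E → E} (hF : Continuous (Function.uncurry F)) (a : ℝ) (x : E) (n : ℕ) :
    Continuous (pic F a x n) := by
  induction n with
  | zero => exact continuous_const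
  | succ n ih =>
    have : Continuous fun r => F r (pic F a x n r) := hF.comp (continuous_id.prodMk ih)
    exact continuous_const.add (intervalIntegral.continuous_primitive
      (fun _ _ => this.intervalIntegrable _ _) _)

lemma vr_int_exp {K a s : ℝ} (hK : 0 < K) :
    ∫ r in a..s, K * Real.exp (2 * K * (r - a)) = (Real.exp (2 * K * (s - a)) - 1) / 2 := by
  have h : ∀ r, HasDerivAt (fun r => Real.exp (2 * K * (r - a)) / 2)
      (K * Real.exp (2 * K * (r - a))) r := fun r => by
    have := ((((hasDerivAt_id r).sub_const a).const_mul (2 * K)).exp).div_const 2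
    refine this.congr_deriv ?_
    simp only [id_eq]; ring
  rw [intervalIntegral.integral_eq_sub_of_hasDerivAt (fun r _ => h r)
    (by apply Continuous.intervalIntegrable; fun_prop)]
  simp; ring

lemma pic_step {F : ℝ → E → E} (hF : Continuous (Function.uncurry F)) {K : ℝ} (hK : 0 < K)
    (hL : ∀ r x y, ‖F r x - F r y‖ ≤ K * ‖x - y‖) {a c : ℝ} {x : E} {D : ℝ}
    {y z : ℝ → E} (hy : Continuous y) (hz : Continuous z)
    (h : ∀ s ∈ Icc a c, ‖y s - z s‖ ≤ D * Real.exp (2 * K * (s - a))) :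
    ∀ s ∈ Icc a c, ‖(x + ∫ r in a..s, F r (y r)) - (x + ∫ r in a..s, F r (z r))‖
      ≤ D / 2 * Real.exp (2 * K * (s - a)) := by
  intro s hs
  have hcy : Continuous fun r => F r (y r) := hF.comp (continuous_id.prodMk hy)
  have hcz : Continuous fun r => F r (z r) := hF.comp (continuous_id.prodMk hz)
  have hD : 0 ≤ D := by
    have := (norm_nonneg _).trans (h a ⟨le_rfl, hs.1.trans hs.2⟩)
    simpa using this
  rw [add_sub_add_left_eq_sub, ← intervalIntegral.integral_sub (hcy.intervalIntegrable _ _)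
    (hcz.intervalIntegrable _ _)]
  calc _ ≤ ∫ r in a..s, D * (K * Real.exp (2 * K * (r - a))) := by
        refine intervalIntegral.norm_integral_le_of_norm_le hs.1 ?_ (by
          apply Continuous.intervalIntegrable; fun_prop)
        refine ae_of_all _ fun r hr => (hL _ _ _).trans ?_
        have := h r ⟨hr.1.le, hr.2.trans hs.2⟩
        nlinarith
    _ = D * ((Real.exp (2 * K * (s - a)) - 1) / 2) := by
        rw [intervalIntegral.integral_const_mul, vr_int_exp hK]
    _ ≤ _ := by nlinarith

lemma pic_bound {F : ℝ → E → E} (hF : Continuous (Function.uncurry F)) {K : ℝ} (hK : 0 < K)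
    (hL : ∀ r x y, ‖F r x - F r y‖ ≤ K * ‖x - y‖) (a c : ℝ) (x : E) :
    ∃ D, 0 ≤ D ∧ ∀ n, ∀ s ∈ Icc a c, ‖pic F a x n s - pic F a x (n+1) s‖ ≤ D / 2 / 2 ^ n := by
  obtain ⟨D, hD⟩ := (isCompact_Icc (a := a) (b := c)).exists_bound_of_continuousOn
    ((pic_cont hF a x 0).sub (pic_cont hF a x 1)).continuousOn
  have hD' : ∀ s ∈ Icc a c, ‖pic F a x 0 s - pic F a x 1 s‖ ≤ |D| :=
    fun s hs => (hD s hs).trans (le_abs_self _)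
  have key : ∀ n, ∀ s ∈ Icc a c, ‖pic F a x n s - pic F a x (n+1) s‖ ≤
      |D| / 2 ^ n * Real.exp (2 * K * (s - a)) := by
    intro n
    induction n with
    | zero =>
      intro s hs
      refine (hD' s hs).trans ?_
      have : 1 ≤ Real.exp (2 * K * (s - a)) :=
        Real.one_le_exp (mul_nonneg (by positivity) (sub_nonneg.2 hs.1))
      simpa using le_mul_of_one_le_right (abs_nonneg D) this
    | succ n ih =>
      intro s hs
      have := pic_step hF hK hL (x := x) (pic_cont hF a x n) (pic_cont hF a x (n+1)) ih s hs
      rw [pow_succ, ← div_div]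
      exact this
  refine ⟨2 * (|D| * Real.exp (2 * K * (c - a))), by positivity, fun n s hs => (key n s hs).trans ?_⟩
  have : Real.exp (2 * K * (s - a)) ≤ Real.exp (2 * K * (c - a)) := by
    apply Real.exp_le_exp.2; nlinarith [hs.2]
  rw [mul_div_cancel_left₀ _ (two_ne_zero), mul_div_right_comm]
  gcongr

lemma vr_picard {F : ℝ → E → E} (hF : Continuous (Function.uncurry F)) {K : ℝ} (hK : 0 < K)
    (hL : ∀ r x y, ‖F r x - F r y‖ ≤ K * ‖x - y‖) (a : ℝ) (x : E) :
    ∃ y : ℝ → E, Continuous y ∧ (∀ s, a ≤ s → y s = x + ∫ r in a..s, F r (y r)) ∧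
      (∀ s, a ≤ s → Tendsto (fun n => pic F a x n s) atTop (𝓝 (y s))) ∧
      ∀ s, y s = y (max a s) := by
  have hlim : ∀ s, ∃ l, Tendsto (fun n => pic F a x n (max a s)) atTop (𝓝 l) := by
    intro s
    obtain ⟨D, hD0, hD⟩ := pic_bound hF hK hL a (max a s) x
    refine cauchySeq_tendsto_of_complete (cauchySeq_of_le_geometric_two (C := D) fun n => ?_)
    rw [dist_eq_norm]
    exact hD n _ ⟨le_max_left _ _, le_rfl⟩
  choose y hy using hlim
  have hunif : ∀ c, ∃ D, 0 ≤ D ∧ ∀ s ≤ c, ∀ n, dist (pic F a x n (max a s)) (y s) ≤ D / 2 ^ n := by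
    intro c
    obtain ⟨D, hD0, hD⟩ := pic_bound hF hK hL a (max a c) x
    refine ⟨D, hD0, fun s hs n => dist_le_of_le_geometric_two_of_tendsto (fun n => ?_) (hy s) n⟩
    rw [dist_eq_norm]
    exact hD n _ ⟨le_max_left _ _, max_le_max le_rfl hs⟩
  have hDt : ∀ D : ℝ, Tendsto (fun n : ℕ => D / 2 ^ n) atTop (𝓝 0) := fun D => by
    have := (tendsto_pow_atTop_nhds_zero_of_lt_one (r := (1/2:ℝ)) (by norm_num)
      (by norm_num)).const_mul D
    simpa [div_eq_mul_inv] using this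
  have hyc : Continuous y := by
    have : TendstoLocallyUniformly (fun n s => pic F a x n (max a s)) y atTop := by
      rw [Metric.tendstoLocallyUniformly_iff]
      intro ε hε s
      obtain ⟨D, hD0, hD⟩ := hunif (s + 1)
      refine ⟨Iic (s+1), Iic_mem_nhds (by linarith), ?_⟩
      filter_upwards [(hDt D).eventually (gt_mem_nhds hε)] with n hn r hr
      rw [dist_comm]
      exact (hD r hr n).trans_lt hn
    exact this.continuous (Eventually.of_forall fun n =>
      (pic_cont hF a x n).comp (continuous_const.max continuous_id)).frequently
  have hyt : ∀ s, a ≤ s → Tendsto (fun n => pic F a x n s) atTop (𝓝 (y s)) := fun s hs => by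
    simpa [max_eq_right hs] using hy s
  refine ⟨y, hyc, fun s hs => ?_, hyt, fun s => tendsto_nhds_unique (hy s) (by
    simpa using hy (max a s))⟩
  have h1 := (hyt s hs).comp (tendsto_add_atTop_nat 1)
  refine tendsto_nhds_unique h1 ?_
  show Tendsto (fun n => x + ∫ r in a..s, F r (pic F a x n r)) atTop _
  refine Tendsto.const_add _ ?_
  obtain ⟨D, hD0, hD⟩ := hunif s
  obtain ⟨B, hB⟩ := (isCompact_Icc (a := a) (b := s)).exists_bound_of_continuousOn
    (f := fun r => F r (y r)) (hF.comp (continuous_id.prodMk hyc)).continuousOn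
  refine intervalIntegral.tendsto_integral_filter_of_dominated_convergence (fun _ => B + K * D) ?_ ?_
    intervalIntegrable_const ?_
  · exact Eventually.of_forall fun n =>
      (hF.comp (continuous_id.prodMk (pic_cont hF a x n))).aestronglyMeasurable
  · refine Eventually.of_forall fun n => ae_of_all _ fun r hr => ?_
    rw [uIoc_of_le hs] at hr
    have h2 := hD r hr.2 n
    rw [max_eq_right hr.1.le, dist_eq_norm] at h2
    have h3 : D / 2 ^ n ≤ D := div_le_self hD0 (one_le_pow₀ (by norm_num))
    calc ‖F r (pic F a x n r)‖ = ‖F r (y r) + (F r (pic F a x n r) - F r (y r))‖ := by congr 1; abel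
      _ ≤ B + K * ‖pic F a x n r - y r‖ :=
        (norm_add_le _ _).trans (add_le_add (hB r ⟨hr.1.le, hr.2⟩) (hL _ _ _))
      _ ≤ _ := by gcongr; exact h2.trans h3
  · refine ae_of_all _ fun r hr => ?_
    rw [uIoc_of_le hs] at hr
    exact ((hF.comp (continuous_const.prodMk continuous_id)).tendsto _).comp (hyt r hr.1.le)

/-- Gronwall for solutions of linear-type integral equations. -/
lemma vr_lin_gronwall {y g : ℝ → E} {e : ℝ → ℝ} {y0 : E} {L a c : ℝ} (hL : 0 ≤ L)
    (hy : Continuous y) (he : Continuous e) (he0 : ∀ r, 0 ≤ e r)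
    (heq : ∀ s ∈ Icc a c, y s = y0 + ∫ r in a..s, g r)
    (hb : ∀ r ∈ Icc a c, ‖g r‖ ≤ e r + L * ‖y r‖) :
    ∀ s ∈ Icc a c, ‖y s‖ ≤ (‖y0‖ + ∫ r in a..c, e r) * Real.exp (L * (s - a)) := by
  rcases le_or_gt a c with hac | hac
  swap
  · intro s hs; exact absurd (hs.1.trans hs.2) (not_le.2 hac)
  refine vr_gronwall hy.norm (fun _ => norm_nonneg _)
    (add_nonneg (norm_nonneg _) (intervalIntegral.integral_nonneg hac fun r _ => he0 r)) hL ?_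
  intro s hs
  rw [heq s hs]
  have h1 : ‖∫ r in a..s, g r‖ ≤ ∫ r in a..s, (e r + L * ‖y r‖) :=
    intervalIntegral.norm_integral_le_of_norm_le hs.1
      (ae_of_all _ fun r hr => hb r ⟨hr.1.le, hr.2.trans hs.2⟩)
      (by apply Continuous.intervalIntegrable; fun_prop)
  have h2 : ∫ r in a..s, (e r + L * ‖y r‖) = (∫ r in a..s, e r) + L * ∫ r in a..s, ‖y r‖ := by
    rw [intervalIntegral.integral_add (he.intervalIntegrable _ _)
      (by apply Continuous.intervalIntegrable; fun_prop), intervalIntegral.integral_const_mul]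
  have h3 : ∫ r in a..s, e r ≤ ∫ r in a..c, e r :=
    intervalIntegral.integral_mono_interval le_rfl hs.1 hs.2 (ae_of_all _ he0)
      (he.intervalIntegrable _ _)
  have := norm_add_le y0 (∫ r in a..s, g r)
  linarith

end picard

/-! ## Part 5 -/
/-- A regular divergence free time dependent vector field. -/
structure GoodField (b : ℝ → Euc 2 → Euc 2) (L : ℝ) : Prop where
  cont : Continuous (Function.uncurry b)
  smooth : ∀ r, ContDiff ℝ 2 (b r)
  dcont : Continuous (fun z : ℝ × Euc 2 => fderiv ℝ (b z.1) z.2)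
  bd : ∀ r x, ‖fderiv ℝ (b r) x‖ ≤ L
  div : ∀ r x, divg (b r) x = 0
  pos : 0 < L

/-- The flow of a field, frozen before time `a`. -/
structure IsFlow (b : ℝ → Euc 2 → Euc 2) (a : ℝ) (Z : ℝ → Euc 2 → Euc 2) : Prop where
  cont : ∀ x, Continuous fun s => Z s x
  eq : ∀ x s, a ≤ s → Z s x = x + ∫ r in a..s, b r (Z r x)
  init : ∀ x s, Z s x = Z (max a s) x

namespace GoodField
variable {b : ℝ → Euc 2 → Euc 2} {L : ℝ} (hb : GoodField b L)
include hb

lemma lip (r : ℝ) (x y : Euc 2) : ‖b r x - b r y‖ ≤ L * ‖x - y‖ :=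
  Convex.norm_image_sub_le_of_norm_fderiv_le (𝕜 := ℝ) (s := univ)
    (fun z _ => (hb.smooth r).differentiable (by norm_num) z)
    (fun z _ => hb.bd r z) convex_univ (mem_univ _) (mem_univ _)

lemma exists_flow (a : ℝ) : ∃ Z, IsFlow b a Z ∧
    ∀ x s, a ≤ s → Tendsto (fun n => pic b a x n s) atTop (𝓝 (Z s x)) := by
  choose y h1 h2 h3 h4 using fun x => vr_picard hb.cont hb.pos hb.lip a x
  exact ⟨fun s x => y x s, ⟨h1, h2, h4⟩, h3⟩

variable {a : ℝ} {Z : ℝ → Euc 2 → Euc 2} (hZ : IsFlow b a Z)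
include hZ

omit hb in
lemma initial (x : Euc 2) : Z a x = x := by rw [hZ.eq x a le_rfl]; simp

lemma comp_cont (x : Euc 2) : Continuous fun r => b r (Z r x) :=
  hb.cont.comp (continuous_id.prodMk (hZ.cont x))

lemma dcomp_cont (x : Euc 2) : Continuous fun r => fderiv ℝ (b r) (Z r x) :=
  hb.dcont.comp (continuous_id.prodMk (hZ.cont x))

lemma unique {y : ℝ → Euc 2} {c : ℝ} {x : Euc 2} (hy : Continuous y)
    (he : ∀ s ∈ Icc a c, y s = x + ∫ r in a..s, b r (y r)) : ∀ s ∈ Icc a c, y s = Z s x := by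
  intro s hs
  have hcy : Continuous fun r => b r (y r) := hb.cont.comp (continuous_id.prodMk hy)
  have := vr_lin_gronwall (y := fun s => y s - Z s x) (g := fun r => b r (y r) - b r (Z r x))
    (e := fun _ => 0) (y0 := 0) hb.pos.le (hy.sub (hZ.cont x))
    continuous_const (fun _ => le_rfl) (fun s hs => by
      rw [intervalIntegral.integral_sub (hcy.intervalIntegrable _ _)
        ((hb.comp_cont hZ x).intervalIntegrable _ _), zero_add]
      simp only [he s hs, hZ.eq x s hs.1]; abel)
    (fun r _ => by simpa using hb.lip r (y r) (Z r x)) s hs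
  simpa [sub_eq_zero] using this

lemma flow_lip (x y : Euc 2) {s c : ℝ} (hs : s ∈ Icc a c) :
    ‖Z s x - Z s y‖ ≤ ‖x - y‖ * Real.exp (L * (c - a)) := by
  have := vr_lin_gronwall (y := fun s => Z s x - Z s y) (g := fun r => b r (Z r x) - b r (Z r y))
    (e := fun _ => 0) (y0 := x - y) hb.pos.le ((hZ.cont x).sub (hZ.cont y))
    continuous_const (fun _ => le_rfl) (fun s hs => by
      rw [intervalIntegral.integral_sub ((hb.comp_cont hZ x).intervalIntegrable _ _)
        ((hb.comp_cont hZ y).intervalIntegrable _ _)]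
      rw [hZ.eq x s hs.1, hZ.eq y s hs.1]; abel)
    (fun r _ => by simpa using hb.lip r (Z r x) (Z r y)) s hs
  refine this.trans ?_
  simp only [intervalIntegral.integral_zero, add_zero]
  have h0 := hb.pos
  have := hs.2
  gcongr

lemma flow_cont (s : ℝ) : Continuous (Z s) := by
  have : Continuous (Z (max a s)) := by
    refine LipschitzWith.continuous (K := (Real.exp (L * (max a s - a))).toNNReal) ?_
    refine LipschitzWith.of_dist_le_mul fun x y => ?_
    rw [dist_eq_norm, dist_eq_norm, Real.coe_toNNReal _ (Real.exp_pos _).le, mul_comm]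
    exact hb.flow_lip hZ x y ⟨le_max_left _ _, le_rfl⟩
  exact this.congr fun x => (hZ.init x s).symm

lemma exists_M (x : Euc 2) : ∃ M : ℝ → (Euc 2 →L[ℝ] Euc 2), Continuous M ∧
    ∀ s, a ≤ s → M s = ContinuousLinearMap.id ℝ _ +
      ∫ r in a..s, (fderiv ℝ (b r) (Z r x)).comp (M r) := by
  obtain ⟨M, h1, h2, -, -⟩ := vr_picard
    (F := fun r (m : Euc 2 →L[ℝ] Euc 2) => (fderiv ℝ (b r) (Z r x)).comp m)
    (K := L) (by
      exact ((hb.dcomp_cont hZ x).comp continuous_fst).clm_comp continuous_snd) hb.pos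
    (fun r m n => by
      rw [← ContinuousLinearMap.comp_sub]
      refine (ContinuousLinearMap.opNorm_comp_le _ _).trans ?_
      have := hb.bd r (Z r x)
      gcongr) a (ContinuousLinearMap.id ℝ _)
  exact ⟨M, h1, h2⟩

end GoodField

/-! ## Part 6 -/
lemma vr_det_eq (M : Euc 2 →L[ℝ] Euc 2) : M.det = jdet M := by
  rw [ContinuousLinearMap.det, ← LinearMap.det_toMatrix (EuclideanSpace.basisFun (Fin 2) ℝ).toBasis,
    Matrix.det_fin_two]
  simp [LinearMap.toMatrix_apply, jdet, ee]
  ring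

lemma vr_measure_le {Φ : Euc 2 → Euc 2} (hΦ : ContDiff ℝ 1 Φ) (hinj : Function.Injective Φ)
    (hdet : ∀ x, jdet (fderiv ℝ Φ x) = 1) (F : Euc 2 → ℝ≥0∞) :
    ∫⁻ x, F (Φ x) ≤ ∫⁻ x, F x := by
  have := lintegral_image_eq_lintegral_abs_det_fderiv_mul (volume : Measure (Euc 2))
    (s := univ) MeasurableSet.univ (f := Φ) (f' := fun x => fderiv ℝ Φ x)
    (fun x _ => ((hΦ.differentiable one_ne_zero) x).hasFDerivAt.hasFDerivWithinAt) hinj.injOn F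
  simp only [vr_det_eq, hdet, abs_one, ENNReal.ofReal_one, one_mul, Measure.restrict_univ] at this
  rw [← this]
  exact setLIntegral_le_lintegral _ _

namespace GoodField
set_option linter.unusedSectionVars false
variable {b : ℝ → Euc 2 → Euc 2} {L : ℝ} (hb : GoodField b L)
  {a : ℝ} {Z : ℝ → Euc 2 → Euc 2} (hZ : IsFlow b a Z)

/-- The tangent flow equation. -/
def IsM (b : ℝ → Euc 2 → Euc 2) (a : ℝ) (Z : ℝ → Euc 2 → Euc 2) (x : Euc 2)
    (M : ℝ → (Euc 2 →L[ℝ] Euc 2)) : Prop := Continuous M ∧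
    ∀ s, a ≤ s → M s = ContinuousLinearMap.id ℝ _ +
      ∫ r in a..s, (fderiv ℝ (b r) (Z r x)).comp (M r)

include hb hZ

lemma M_cont {x : Euc 2} {M : ℝ → (Euc 2 →L[ℝ] Euc 2)} (hM : IsM b a Z x M) :
    Continuous fun r => (fderiv ℝ (b r) (Z r x)).comp (M r) :=
  (hb.dcomp_cont hZ x).clm_comp hM.1

lemma M_bound {x : Euc 2} {M : ℝ → (Euc 2 →L[ℝ] Euc 2)} (hM : IsM b a Z x M) {s c : ℝ}
    (hs : s ∈ Icc a c) : ‖M s‖ ≤ Real.exp (L * (c - a)) := by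
  have := vr_lin_gronwall (y := M) (g := fun r => (fderiv ℝ (b r) (Z r x)).comp (M r))
    (e := fun _ => 0) (c := c) hb.pos.le hM.1 continuous_const (fun _ => le_rfl) (fun s hs => hM.2 s hs.1)
    (fun r _ => by
      rw [zero_add]
      exact (ContinuousLinearMap.opNorm_comp_le _ _).trans
        (mul_le_mul_of_nonneg_right (hb.bd _ _) (norm_nonneg _))) s hs
  refine this.trans ?_
  have h1 : ‖ContinuousLinearMap.id ℝ (Euc 2)‖ ≤ 1 := ContinuousLinearMap.norm_id_le
  have h2 : Real.exp (L * (s - a)) ≤ Real.exp (L * (c - a)) := by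
    have h0 := hb.pos
    have := hs.2
    gcongr
  simp only [intervalIntegral.integral_zero, add_zero]
  calc _ ≤ 1 * Real.exp (L * (c - a)) := by gcongr
    _ = _ := one_mul _

lemma M_diff {x x' : Euc 2} {M M' : ℝ → (Euc 2 →L[ℝ] Euc 2)} (hM : IsM b a Z x M)
    (hM' : IsM b a Z x' M') {c : ℝ} (hc : a ≤ c) : ‖M' c - M c‖ ≤
      Real.exp (L * (c - a)) ^ 2 *
        ∫ r in a..c, ‖fderiv ℝ (b r) (Z r x') - fderiv ℝ (b r) (Z r x)‖ := by
  have hA := hb.dcomp_cont hZ x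
  have hA' := hb.dcomp_cont hZ x'
  have hcM := hM.1
  have hcM' := hM'.1
  have := vr_lin_gronwall (y := fun s => M' s - M s)
    (g := fun r => (fderiv ℝ (b r) (Z r x')).comp (M' r) - (fderiv ℝ (b r) (Z r x)).comp (M r))
    (e := fun r => ‖fderiv ℝ (b r) (Z r x') - fderiv ℝ (b r) (Z r x)‖ * ‖M' r‖) (y0 := 0)
    (c := c) (a := a) hb.pos.le (hcM'.sub hcM) ((hA'.sub hA).norm.mul hcM'.norm)
    (fun _ => by positivity) (fun s hs => by
      rw [intervalIntegral.integral_sub ((hb.M_cont hZ hM').intervalIntegrable _ _)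
        ((hb.M_cont hZ hM).intervalIntegrable _ _), zero_add]
      rw [hM.2 s hs.1, hM'.2 s hs.1]; abel)
    (fun r _ => by
      have : (fderiv ℝ (b r) (Z r x')).comp (M' r) - (fderiv ℝ (b r) (Z r x)).comp (M r) =
          (fderiv ℝ (b r) (Z r x') - fderiv ℝ (b r) (Z r x)).comp (M' r) +
            (fderiv ℝ (b r) (Z r x)).comp (M' r - M r) := by
        ext v; simp
      rw [this]
      refine (norm_add_le _ _).trans (add_le_add (ContinuousLinearMap.opNorm_comp_le _ _) ?_)
      exact (ContinuousLinearMap.opNorm_comp_le _ _).trans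
        (mul_le_mul_of_nonneg_right (hb.bd _ _) (norm_nonneg _))) c ⟨hc, le_rfl⟩
  refine this.trans ?_
  rw [norm_zero, zero_add, pow_two, mul_comm, mul_assoc]
  refine mul_le_mul_of_nonneg_left ?_ (Real.exp_pos _).le
  rw [← intervalIntegral.integral_const_mul]
  refine intervalIntegral.integral_mono_on hc (by
    apply Continuous.intervalIntegrable; fun_prop) (by
    apply Continuous.intervalIntegrable; fun_prop) fun r hr => ?_
  rw [mul_comm]
  exact mul_le_mul_of_nonneg_right (hb.M_bound hZ hM' hr) (norm_nonneg _)

lemma flow_hasFDerivAt {x : Euc 2} {M : ℝ → (Euc 2 →L[ℝ] Euc 2)} (hM : IsM b a Z x M) {c : ℝ}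
    (hc : a ≤ c) : HasFDerivAt (Z c) (M c) x := by
  set R := Real.exp (L * (c - a)) with hR
  have hR0 : 0 < R := Real.exp_pos _
  set e : Euc 2 → ℝ → ℝ := fun h r => ‖b r (Z r (x + h)) - b r (Z r x) -
    fderiv ℝ (b r) (Z r x) (Z r (x + h) - Z r x)‖ with he
  have hec : ∀ h, Continuous (e h) := fun h =>
    (((hb.comp_cont hZ _).sub (hb.comp_cont hZ _)).sub ((hb.dcomp_cont hZ x).clm_apply
      ((hZ.cont _).sub (hZ.cont _)))).norm
  have hebd : ∀ h, ∀ r ∈ Icc a c, e h r ≤ 2 * L * R * ‖h‖ := by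
    intro h r hr
    have h1 := hb.flow_lip hZ (x + h) x hr
    rw [add_sub_cancel_left] at h1
    have h2 := hb.lip r (Z r (x + h)) (Z r x)
    have h3 := (fderiv ℝ (b r) (Z r x)).le_of_opNorm_le (hb.bd r (Z r x)) (Z r (x + h) - Z r x)
    have h4 : L * ‖Z r (x + h) - Z r x‖ ≤ L * (‖h‖ * R) := mul_le_mul_of_nonneg_left h1 hb.pos.le
    calc e h r ≤ _ := norm_sub_le _ _
      _ ≤ _ := by linarith
  have key : ∀ h, ‖Z c (x + h) - Z c x - M c h‖ ≤ (∫ r in a..c, e h r) * R := by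
    intro h
    have hMh : Continuous fun s => M s h := hM.1.clm_apply continuous_const
    have hAMh : Continuous fun r => fderiv ℝ (b r) (Z r x) (M r h) :=
      (hb.dcomp_cont hZ x).clm_apply hMh
    have hsub : Continuous fun r => b r (Z r (x + h)) - b r (Z r x) :=
      (hb.comp_cont hZ _).sub (hb.comp_cont hZ _)
    have := vr_lin_gronwall (y := fun s => Z s (x + h) - Z s x - M s h)
      (g := fun r => b r (Z r (x + h)) - b r (Z r x) - fderiv ℝ (b r) (Z r x) (M r h))
      (e := e h) (y0 := 0) (c := c) (a := a) hb.pos.le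
      (((hZ.cont _).sub (hZ.cont _)).sub hMh) (hec h)
      (fun _ => norm_nonneg _) (fun s hs => by
        rw [intervalIntegral.integral_sub
          (hsub.intervalIntegrable _ _)
          (hAMh.intervalIntegrable _ _),
          intervalIntegral.integral_sub ((hb.comp_cont hZ _).intervalIntegrable _ _)
          ((hb.comp_cont hZ _).intervalIntegrable _ _), zero_add]
        have h1 := hM.2 s hs.1
        have h2 : M s h = h + ∫ r in a..s, fderiv ℝ (b r) (Z r x) (M r h) := by
          rw [h1, ContinuousLinearMap.add_apply,
            ContinuousLinearMap.intervalIntegral_apply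
              ((hb.M_cont hZ hM).intervalIntegrable _ _)]
          simp
        rw [h2, hZ.eq (x + h) s hs.1, hZ.eq x s hs.1]; abel)
      (fun r _ => by
        have : b r (Z r (x + h)) - b r (Z r x) - fderiv ℝ (b r) (Z r x) (M r h) =
          (b r (Z r (x + h)) - b r (Z r x) - fderiv ℝ (b r) (Z r x) (Z r (x + h) - Z r x)) +
            fderiv ℝ (b r) (Z r x) (Z r (x + h) - Z r x - M r h) := by
          simp only [map_sub]; abel
        rw [this]
        refine (norm_add_le _ _).trans (add_le_add le_rfl ?_)
        exact ContinuousLinearMap.le_of_opNorm_le _ (hb.bd _ _) _) c ⟨hc, le_rfl⟩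
    simpa using this
  rw [hasFDerivAt_iff_isLittleO_nhds_zero]
  have hlim : Tendsto (fun h => ∫ r in a..c, e h r / ‖h‖) (𝓝 (0:Euc 2)) (𝓝 (∫ r in a..c, (0:ℝ))) := by
    refine intervalIntegral.tendsto_integral_filter_of_dominated_convergence (fun _ => 2 * L * R)
      ?_ ?_ intervalIntegrable_const ?_
    · exact Eventually.of_forall fun h => ((hec h).div_const _).aestronglyMeasurable
    · refine Eventually.of_forall fun h => ae_of_all _ fun r hr => ?_
      rw [uIoc_of_le hc] at hr
      rw [Real.norm_of_nonneg (by positivity)]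
      rcases eq_or_ne h 0 with rfl | hh
      · have := hb.pos; simp; positivity
      · rw [div_le_iff₀ (norm_pos_iff.2 hh)]
        exact hebd h r ⟨hr.1.le, hr.2⟩
    · refine ae_of_all _ fun r hr => ?_
      rw [uIoc_of_le hc] at hr
      have hd : HasFDerivAt (b r) (fderiv ℝ (b r) (Z r x)) (Z r x) :=
        (((hb.smooth r).differentiable (by norm_num)) _).hasFDerivAt
      have hZc : Tendsto (fun h => Z r (x + h)) (𝓝 0) (𝓝 (Z r x)) := by
        have := ((hb.flow_cont hZ r).comp (continuous_const.add continuous_id)).tendsto (x := (0:Euc 2))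
          (f := fun h => Z r (x + h))
        simpa using this
      have h1 := hd.isLittleO.comp_tendsto hZc
      have h2 : (fun h => Z r (x + h) - Z r x) =O[𝓝 0] fun h : Euc 2 => h := by
        refine Asymptotics.IsBigO.of_bound R (Eventually.of_forall fun h => ?_)
        have := hb.flow_lip hZ (x + h) x (s := r) (c := c) ⟨hr.1.le, hr.2⟩
        rw [add_sub_cancel_left] at this
        linarith
      have h3 := (h1.trans_isBigO h2).norm_norm
      exact h3.tendsto_div_nhds_zero
  rw [intervalIntegral.integral_zero] at hlim
  refine Asymptotics.IsBigO.trans_isLittleO (g := fun h => ∫ r in a..c, e h r) ?_ ?_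
  · refine Asymptotics.IsBigO.of_bound R (Eventually.of_forall fun h => (key h).trans ?_)
    rw [mul_comm]
    exact mul_le_mul_of_nonneg_left (le_abs_self _) hR0.le
  · refine Asymptotics.IsLittleO.of_norm_right ?_
    refine (Asymptotics.isLittleO_iff_tendsto ?_).2 ?_
    · intro h hh
      rw [norm_eq_zero] at hh; subst hh; simp [he]
    · simpa only [intervalIntegral.integral_div] using hlim

lemma flow_contDiff {c : ℝ} (hc : a ≤ c) : ContDiff ℝ 1 (Z c) := by
  choose M hM using hb.exists_M hZ
  have hd : ∀ x, HasFDerivAt (Z c) (M x c) x := fun x => hb.flow_hasFDerivAt hZ (hM x) hc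
  rw [contDiff_one_iff_fderiv]
  refine ⟨fun x => (hd x).differentiableAt, ?_⟩
  have : fderiv ℝ (Z c) = fun x => M x c := funext fun x => (hd x).fderiv
  rw [this, continuous_iff_continuousAt]
  intro x
  rw [ContinuousAt, tendsto_iff_norm_sub_tendsto_zero]
  have hlim : Tendsto (fun x' => ∫ r in a..c, ‖fderiv ℝ (b r) (Z r x') - fderiv ℝ (b r) (Z r x)‖)
      (𝓝 x) (𝓝 (∫ r in a..c, (0:ℝ))) := by
    refine intervalIntegral.tendsto_integral_filter_of_dominated_convergence (fun _ => L + L)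
      ?_ ?_ intervalIntegrable_const ?_
    · exact Eventually.of_forall fun h =>
        ((hb.dcomp_cont hZ _).sub (hb.dcomp_cont hZ _)).norm.aestronglyMeasurable
    · refine Eventually.of_forall fun h => ae_of_all _ fun r hr => ?_
      rw [norm_norm]
      exact (norm_sub_le _ _).trans (add_le_add (hb.bd _ _) (hb.bd _ _))
    · refine ae_of_all _ fun r hr => ?_
      rw [← tendsto_iff_norm_sub_tendsto_zero]
      exact (hb.dcont.comp (continuous_const.prodMk (hb.flow_cont hZ r))).tendsto x
  rw [intervalIntegral.integral_zero] at hlim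
  refine squeeze_zero (fun _ => norm_nonneg _) (fun x' => hb.M_diff hZ (hM x) (hM x') hc) ?_
  simpa using hlim.const_mul (Real.exp (L * (c - a)) ^ 2)

lemma flow_fderiv_bound {c : ℝ} (hc : a ≤ c) (x : Euc 2) :
    ‖fderiv ℝ (Z c) x‖ ≤ Real.exp (L * (c - a)) := by
  obtain ⟨M, hM⟩ := hb.exists_M hZ x
  rw [(hb.flow_hasFDerivAt hZ hM hc).fderiv]
  exact hb.M_bound hZ hM ⟨hc, le_rfl⟩

lemma flow_fderiv_diff {c : ℝ} (hc : a ≤ c) (x x' : Euc 2) :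
    ‖fderiv ℝ (Z c) x' - fderiv ℝ (Z c) x‖ ≤ Real.exp (L * (c - a)) ^ 2 *
        ∫ r in a..c, ‖fderiv ℝ (b r) (Z r x') - fderiv ℝ (b r) (Z r x)‖ := by
  obtain ⟨M, hM⟩ := hb.exists_M hZ x
  obtain ⟨M', hM'⟩ := hb.exists_M hZ x'
  rw [(hb.flow_hasFDerivAt hZ hM hc).fderiv, (hb.flow_hasFDerivAt hZ hM' hc).fderiv]
  exact hb.M_diff hZ hM hM' hc

lemma flow_jdet {c : ℝ} (hc : a ≤ c) (x : Euc 2) : jdet (fderiv ℝ (Z c) x) = 1 := by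
  obtain ⟨M, hM⟩ := hb.exists_M hZ x
  rw [(hb.flow_hasFDerivAt hZ hM hc).fderiv]
  have hcont := hb.M_cont hZ hM
  have hder : ∀ s, HasDerivAt (fun s => ContinuousLinearMap.id ℝ (Euc 2) +
      ∫ r in a..s, (fderiv ℝ (b r) (Z r x)).comp (M r)) ((fderiv ℝ (b s) (Z s x)).comp (M s)) s :=
    fun s => (intervalIntegral.integral_hasDerivAt_right (hcont.intervalIntegrable _ _)
      (hcont.stronglyMeasurableAtFilter _ _) hcont.continuousAt).const_add _
  have hMd : ∀ s ∈ Ico a c, HasDerivWithinAt M ((fderiv ℝ (b s) (Z s x)).comp (M s)) (Ici s) s :=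
    fun s hs => (hder s).hasDerivWithinAt.congr (fun r hr => hM.2 r (hs.1.trans hr)) (hM.2 s hs.1)
  have hco : ∀ s ∈ Ico a c, ∀ j i : Fin 2, HasDerivWithinAt (fun s => M s (ee j) i)
      (fderiv ℝ (b s) (Z s x) (M s (ee j)) i) (Ici s) s := fun s hs j i => by
    have h1 := (hMd s hs).clm_apply (hasDerivWithinAt_const s (Ici s) (ee j))
    have h2 := (EuclideanSpace.proj i : Euc 2 →L[ℝ] ℝ).hasFDerivAt.comp_hasDerivWithinAt s h1
    simp only [map_zero, add_zero] at h2
    exact h2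
  have hj : ∀ s ∈ Ico a c, HasDerivWithinAt (fun s => jdet (M s)) 0 (Ici s) s := fun s hs => by
    have := ((hco s hs 0 0).mul (hco s hs 1 1)).sub ((hco s hs 0 1).mul (hco s hs 1 0))
    refine this.congr_deriv ?_
    have hdiv := hb.div s (Z s x)
    simp only [divg, Fin.sum_univ_two] at hdiv
    set A := fderiv ℝ (b s) (Z s x)
    have hA : ∀ v i, A v i = v 0 * A (ee 0) i + v 1 * A (ee 1) i := fun v i => by
      conv_lhs => rw [vr_expand v]
      simp
    rw [hA (M s (ee 0)) 0, hA (M s (ee 0)) 1, hA (M s (ee 1)) 0, hA (M s (ee 1)) 1]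
    linear_combination (M s (ee 0) 0 * M s (ee 1) 1 - M s (ee 0) 1 * M s (ee 1) 0) * hdiv
  have hjc : Continuous fun s => jdet (M s) := by
    have h : ∀ j i : Fin 2, Continuous fun s => M s (ee j) i := fun j i =>
      (EuclideanSpace.proj i : Euc 2 →L[ℝ] ℝ).continuous.comp
        (hM.1.clm_apply continuous_const)
    exact ((h 0 0).mul (h 1 1)).sub ((h 0 1).mul (h 1 0))
  have := constant_of_has_deriv_right_zero hjc.continuousOn hj c ⟨hc, le_rfl⟩
  rw [this, hM.2 a le_rfl]
  simp [jdet, ee]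

lemma flow_inj {c : ℝ} (hc : a ≤ c) : Function.Injective (Z c) := by
  intro x y hxy
  have hd : ∀ x, ∀ s ∈ Ioc a c, HasDerivWithinAt (fun s => Z s x) (b s (Z s x)) (Iic s) s := by
    intro x s hs
    have hcont := hb.comp_cont hZ x
    have h1 : HasDerivAt (fun s => x + ∫ r in a..s, b r (Z r x)) (b s (Z s x)) s :=
      (intervalIntegral.integral_hasDerivAt_right (hcont.intervalIntegrable _ _)
        (hcont.stronglyMeasurableAtFilter _ _) hcont.continuousAt).const_add _
    refine (h1.congr_of_eventuallyEq ?_).hasDerivWithinAt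
    filter_upwards [Ioi_mem_nhds hs.1] with r hr
    exact hZ.eq x r (le_of_lt hr)
  have := ODE_solution_unique_of_mem_Icc_left (v := b) (s := fun _ => univ) (K := L.toNNReal)
    (f := fun s => Z s x) (g := fun s => Z s y) (a := a) (b := c)
    (fun t _ => LipschitzOnWith.of_dist_le_mul fun x _ y _ => by
      rw [dist_eq_norm, dist_eq_norm, Real.coe_toNNReal _ hb.pos.le]; exact hb.lip t x y)
    (hZ.cont x).continuousOn (hd x) (fun _ _ => mem_univ _)
    (hZ.cont y).continuousOn (hd y) (fun _ _ => mem_univ _) hxy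
  have h := this ⟨le_rfl, hc⟩
  simpa [initial hZ] using h

end GoodField

/-! ## Part 7 -/
lemma vr_eLp_comp {F : Type*} [NormedAddCommGroup F] {Φ : Euc 2 → Euc 2} (hΦ : ContDiff ℝ 1 Φ)
    (hinj : Function.Injective Φ)
    (hdet : ∀ x, jdet (fderiv ℝ Φ x) = 1) (f : Euc 2 → F) {p : ℝ} (hp : 1 ≤ p) (h : Euc 2) :
    eLpNorm (fun x => f (Φ (x + h))) (ENNReal.ofReal p) volume ≤
      eLpNorm f (ENNReal.ofReal p) volume := by
  rw [vr_eLpNorm_eq p hp, vr_eLpNorm_eq p hp]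
  have h1 : ∫⁻ x, ‖f (Φ (x + h))‖ₑ ^ p = ∫⁻ x, ‖f (Φ x)‖ₑ ^ p :=
    lintegral_add_right_eq_self (fun x => ‖f (Φ x)‖ₑ ^ p) h
  have h2 := vr_measure_le hΦ hinj hdet (fun x => ‖f x‖ₑ ^ p)
  rw [h1]
  exact ENNReal.rpow_le_rpow h2 (by positivity)

lemma vr_mvt {F : Type*} [NormedAddCommGroup F] [NormedSpace ℝ F] [CompleteSpace F]
    {G : Euc 2 → F} (hG : ContDiff ℝ 1 G) (x h : Euc 2) :
    ‖G (x + h) - G x‖ₑ ≤ ‖h‖ₑ * ∫⁻ θ in Ioc (0:ℝ) 1, ‖fderiv ℝ G (x + θ • h)‖ₑ := by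
  have hc : Continuous fun θ : ℝ => fderiv ℝ G (x + θ • h) :=
    (hG.continuous_fderiv one_ne_zero).comp (by fun_prop)
  have hd : ∀ θ : ℝ, HasDerivAt (fun θ : ℝ => G (x + θ • h)) (fderiv ℝ G (x + θ • h) h) θ := fun θ => by
    have h1 : HasDerivAt (fun θ : ℝ => x + θ • h) h θ := by
      simpa using ((hasDerivAt_id θ).smul_const h).const_add x
    exact (((hG.differentiable one_ne_zero) _).hasFDerivAt).comp_hasDerivAt θ h1
  have := intervalIntegral.integral_eq_sub_of_hasDerivAt (a := 0) (b := 1) (fun θ _ => hd θ)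
    ((hc.clm_apply continuous_const).intervalIntegrable _ _)
  simp only [one_smul, zero_smul, add_zero] at this
  rw [← this, intervalIntegral.integral_of_le zero_le_one, mul_comm,
    ← lintegral_mul_const _ hc.enorm.measurable]
  refine (enorm_integral_le_lintegral_enorm _).trans (lintegral_mono fun θ => ?_)
  exact (fderiv ℝ G (x + θ • h)).le_opENorm h

namespace GoodField
variable {b : ℝ → Euc 2 → Euc 2} {L : ℝ} (hb : GoodField b L)
  {a : ℝ} {Z : ℝ → Euc 2 → Euc 2} (hZ : IsFlow b a Z)
include hb hZ

lemma flow_dq_time {p : ℝ} (hp : 1 ≤ p) {D : ℝ≥0∞}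
    (hD : ∀ r, eLpNorm (fderiv ℝ (fderiv ℝ (b r))) (ENNReal.ofReal p) volume ≤ D)
    {c r : ℝ} (hr : r ∈ Icc a c) (A : Set (Euc 2)) (h : Euc 2) :
    ∫⁻ x in A, ‖fderiv ℝ (b r) (Z r (x + h)) - fderiv ℝ (b r) (Z r x)‖ₑ ≤
      ‖h‖ₑ * (ENNReal.ofReal (Real.exp (L * (c - a))) * (D * volume A ^ (1 - 1 / p))) := by
  set R := Real.exp (L * (c - a))
  have hZ1 := hb.flow_contDiff hZ hr.1
  have hb1 : ContDiff ℝ 1 (fderiv ℝ (b r)) := (hb.smooth r).fderiv_right (by norm_num)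
  have hG : ContDiff ℝ 1 (fun x => fderiv ℝ (b r) (Z r x)) := hb1.comp hZ1
  have hGf : ∀ y, ‖fderiv ℝ (fun x => fderiv ℝ (b r) (Z r x)) y‖ₑ ≤
      ENNReal.ofReal R * ‖fderiv ℝ (fderiv ℝ (b r)) (Z r y)‖ₑ := by
    intro y
    have h1 : fderiv ℝ (fun x => fderiv ℝ (b r) (Z r x)) y =
        (fderiv ℝ (fderiv ℝ (b r)) (Z r y)).comp (fderiv ℝ (Z r) y) :=
      fderiv_comp y ((hb1.differentiable one_ne_zero) _) ((hZ1.differentiable one_ne_zero) _)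
    rw [h1, ← ofReal_norm, ← ofReal_norm, ← ENNReal.ofReal_mul (Real.exp_pos _).le]
    refine ENNReal.ofReal_le_ofReal ((ContinuousLinearMap.opNorm_comp_le _ _).trans ?_)
    rw [mul_comm]
    refine mul_le_mul_of_nonneg_right ((hb.flow_fderiv_bound hZ hr.1 y).trans ?_) (norm_nonneg _)
    have h0 := hb.pos
    have := hr.2
    apply Real.exp_le_exp.2; gcongr
  have hGc := hG.continuous_fderiv one_ne_zero
  calc _ ≤ ∫⁻ x in A, ‖h‖ₑ * ∫⁻ θ in Ioc (0:ℝ) 1,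
        ‖fderiv ℝ (fun x => fderiv ℝ (b r) (Z r x)) (x + θ • h)‖ₑ :=
        lintegral_mono fun x => vr_mvt hG x h
    _ = ‖h‖ₑ * ∫⁻ x in A, ∫⁻ θ in Ioc (0:ℝ) 1,
        ‖fderiv ℝ (fun x => fderiv ℝ (b r) (Z r x)) (x + θ • h)‖ₑ := by
        rw [lintegral_const_mul' _ _ (by simp)]
    _ = ‖h‖ₑ * ∫⁻ θ in Ioc (0:ℝ) 1, ∫⁻ x in A,
        ‖fderiv ℝ (fun x => fderiv ℝ (b r) (Z r x)) (x + θ • h)‖ₑ := by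
        congr 1
        refine lintegral_lintegral_swap (Measurable.aemeasurable ?_)
        have : Continuous fun z : Euc 2 × ℝ =>
          ‖fderiv ℝ (fun x => fderiv ℝ (b r) (Z r x)) (z.1 + z.2 • h)‖ₑ :=
          (hGc.comp (by fun_prop)).enorm
        exact this.measurable
    _ ≤ ‖h‖ₑ * ∫⁻ θ in Ioc (0:ℝ) 1, ENNReal.ofReal R * (D * volume A ^ (1 - 1 / p)) := by
        refine mul_le_mul_right (lintegral_mono fun θ => ?_) _
        calc _ ≤ ∫⁻ x in A, ENNReal.ofReal R * ‖fderiv ℝ (fderiv ℝ (b r)) (Z r (x + θ • h))‖ₑ :=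
              lintegral_mono fun x => hGf _
          _ = ENNReal.ofReal R * ∫⁻ x in A, ‖fderiv ℝ (fderiv ℝ (b r)) (Z r (x + θ • h))‖ₑ :=
              lintegral_const_mul' _ _ (by simp)
          _ ≤ _ := by
              refine mul_le_mul_right ?_ _
              have hcc : Continuous fun x => fderiv ℝ (fderiv ℝ (b r)) (Z r (x + θ • h)) :=
                (hb1.continuous_fderiv one_ne_zero).comp (hZ1.continuous.comp (by fun_prop))
              refine (vr_holder_set p hp (fun x => fderiv ℝ (fderiv ℝ (b r)) (Z r (x + θ • h)))
                hcc.aestronglyMeasurable A).trans ?_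
              refine mul_le_mul_left ?_ _
              exact (vr_eLp_comp hZ1 (hb.flow_inj hZ hr.1) (hb.flow_jdet hZ hr.1) _ hp _).trans (hD r)
    _ = _ := by simp

lemma flow_dq {p : ℝ} (hp : 1 ≤ p) {D : ℝ≥0∞}
    (hD : ∀ r, eLpNorm (fderiv ℝ (fderiv ℝ (b r))) (ENNReal.ofReal p) volume ≤ D)
    {c : ℝ} (hc : a ≤ c) (A : Set (Euc 2)) (h : Euc 2) :
    ∫⁻ x in A, ‖fderiv ℝ (Z c) (x + h) - fderiv ℝ (Z c) x‖ₑ ≤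
      ENNReal.ofReal (Real.exp (L * (c - a)) ^ 3 * (c - a)) *
        (‖h‖ₑ * (D * volume A ^ (1 - 1 / p))) := by
  set R := Real.exp (L * (c - a))
  have hZm : Measurable (Function.uncurry Z) :=
    measurable_uncurry_of_continuous_of_measurable (fun x => hZ.cont x)
      (fun r => (hb.flow_cont hZ r).measurable)
  have hm : Measurable fun z : Euc 2 × ℝ => fderiv ℝ (b z.2) (Z z.2 z.1) := by
    have : Measurable fun z : Euc 2 × ℝ => (z.2, Z z.2 z.1) :=
      measurable_snd.prodMk (hZm.comp (measurable_snd.prodMk measurable_fst))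
    exact hb.dcont.measurable.comp this
  have hm2 : Measurable fun z : Euc 2 × ℝ =>
      ‖fderiv ℝ (b z.2) (Z z.2 (z.1 + h)) - fderiv ℝ (b z.2) (Z z.2 z.1)‖ₑ := by
    have : Measurable fun z : Euc 2 × ℝ => (z.1 + h, z.2) := by fun_prop
    exact ((hm.comp this).sub hm).enorm
  have hpt : ∀ x, ‖fderiv ℝ (Z c) (x + h) - fderiv ℝ (Z c) x‖ₑ ≤ ENNReal.ofReal (R ^ 2) *
      ∫⁻ r in Ioc a c, ‖fderiv ℝ (b r) (Z r (x + h)) - fderiv ℝ (b r) (Z r x)‖ₑ := by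
    intro x
    have h1 := hb.flow_fderiv_diff hZ hc x (x + h)
    have hcont : Continuous fun r => fderiv ℝ (b r) (Z r (x + h)) - fderiv ℝ (b r) (Z r x) :=
      (hb.dcomp_cont hZ _).sub (hb.dcomp_cont hZ _)
    rw [← ofReal_norm]
    refine (ENNReal.ofReal_le_ofReal h1).trans ?_
    rw [ENNReal.ofReal_mul (by positivity), intervalIntegral.integral_of_le hc,
      ofReal_integral_norm_eq_lintegral_enorm
        ((hcont.integrableOn_Icc (a := a) (b := c)).mono_set Ioc_subset_Icc_self)]
  calc _ ≤ ∫⁻ x in A, ENNReal.ofReal (R ^ 2) *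
        ∫⁻ r in Ioc a c, ‖fderiv ℝ (b r) (Z r (x + h)) - fderiv ℝ (b r) (Z r x)‖ₑ :=
        lintegral_mono hpt
    _ = ENNReal.ofReal (R ^ 2) * ∫⁻ r in Ioc a c, ∫⁻ x in A,
        ‖fderiv ℝ (b r) (Z r (x + h)) - fderiv ℝ (b r) (Z r x)‖ₑ := by
        rw [lintegral_const_mul' _ _ (by simp), lintegral_lintegral_swap hm2.aemeasurable]
    _ ≤ ENNReal.ofReal (R ^ 2) * ∫⁻ r in Ioc a c,
        ‖h‖ₑ * (ENNReal.ofReal R * (D * volume A ^ (1 - 1 / p))) := by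
        refine mul_le_mul_right (setLIntegral_mono' measurableSet_Ioc fun r hr => ?_) _
        exact hb.flow_dq_time hZ hp hD ⟨hr.1.le, hr.2⟩ A h
    _ = _ := by
        rw [setLIntegral_const, Real.volume_Ioc]
        have : R ^ 3 * (c - a) = R ^ 2 * R * (c - a) := by ring
        have hR : 0 < R := Real.exp_pos _
        rw [this, ENNReal.ofReal_mul (by positivity), ENNReal.ofReal_mul (by positivity)]
        ring

end GoodField

/-! ## Part 8 -/
/-- A random family of regular area preserving maps. -/
structure FlowFamily {Ω : Type*} [MeasurableSpace Ω] (Φ : Ω → Euc 2 → Euc 2) (C p : ℝ) (D : ℝ≥0∞) :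
    Prop where
  c1 : ∀ ω, ContDiff ℝ 1 (Φ ω)
  inj : ∀ ω, Function.Injective (Φ ω)
  det : ∀ ω x, jdet (fderiv ℝ (Φ ω) x) = 1
  bd : ∀ ω x, ‖fderiv ℝ (Φ ω) x‖ ≤ C
  dq : ∀ ω (A : Set (Euc 2)) h, ∫⁻ x in A, ‖fderiv ℝ (Φ ω) (x + h) - fderiv ℝ (Φ ω) x‖ₑ ≤
    ‖h‖ₑ * (D * volume A ^ (1 - 1 / p))
  meas : ∀ x, Measurable fun ω => Φ ω x

lemma vr_clm_expand (M : Euc 2 →L[ℝ] Euc 2) :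
    M = (EuclideanSpace.proj 0 : Euc 2 →L[ℝ] ℝ).smulRight (M (ee 0)) +
      (EuclideanSpace.proj 1 : Euc 2 →L[ℝ] ℝ).smulRight (M (ee 1)) := by
  ext v i
  conv_lhs => rw [vr_expand v]
  simp

lemma vr_clm_meas {α : Type*} [MeasurableSpace α] {M : α → (Euc 2 →L[ℝ] Euc 2)}
    (h : ∀ i, Measurable fun z => M z (ee i)) : Measurable M := by
  have hc : ∀ i : Fin 2, Continuous fun v : Euc 2 =>
      (EuclideanSpace.proj i : Euc 2 →L[ℝ] ℝ).smulRight v := fun i =>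
    (ContinuousLinearMap.smulRightL ℝ (Euc 2) (Euc 2) (EuclideanSpace.proj i)).continuous
  have := ((hc 0).measurable.comp (h 0)).add ((hc 1).measurable.comp (h 1))
  have he : M = ((fun v : Euc 2 => (EuclideanSpace.proj 0 : Euc 2 →L[ℝ] ℝ).smulRight v) ∘
      fun z => M z (ee 0)) + ((fun v : Euc 2 => (EuclideanSpace.proj 1 : Euc 2 →L[ℝ] ℝ).smulRight v) ∘
      fun z => M z (ee 1)) := funext fun z => vr_clm_expand (M z)
  rw [he]
  exact this

namespace FlowFamily
variable {Ω : Type*} [MeasurableSpace Ω] {Φ : Ω → Euc 2 → Euc 2} {C p : ℝ} {D : ℝ≥0∞}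
  (hΦ : FlowFamily Φ C p D)
include hΦ

lemma jmeas : Measurable fun z : Euc 2 × Ω => Φ z.2 z.1 :=
  measurable_uncurry_of_continuous_of_measurable (u := fun x ω => Φ ω x)
    (fun ω => (hΦ.c1 ω).continuous) hΦ.meas

lemma dmeas (x : Euc 2) : Measurable fun ω => fderiv ℝ (Φ ω) x := by
  refine vr_clm_meas fun i => ?_
  refine measurable_of_tendsto_metrizable (f := fun (n : ℕ) ω =>
    ((n : ℝ) + 1) • (Φ ω (x + ((n : ℝ) + 1)⁻¹ • ee i) - Φ ω x)) (fun n => ?_) ?_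
  · exact ((hΦ.meas _).sub (hΦ.meas _)).const_smul ((n : ℝ) + 1)
  · rw [tendsto_pi_nhds]
    intro ω
    have hd := (((hΦ.c1 ω).differentiable one_ne_zero) x).hasFDerivAt
    exact (hd.lim_real (ee i)).comp
      (tendsto_atTop_add_const_right _ (1:ℝ) tendsto_natCast_atTop_atTop)

lemma djmeas : Measurable fun z : Euc 2 × Ω => fderiv ℝ (Φ z.2) z.1 :=
  measurable_uncurry_of_continuous_of_measurable (u := fun x ω => fderiv ℝ (Φ ω) x)
    (fun ω => (hΦ.c1 ω).continuous_fderiv one_ne_zero) hΦ.dmeas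

lemma Hmeas {v : Euc 2 → Euc 2} (hv : Continuous v) :
    Measurable fun z : Euc 2 × Ω => tJac (Φ z.2) z.1 (v (Φ z.2 z.1)) := by
  have h1 : Measurable fun z : Euc 2 × Ω => tJac (Φ z.2) z.1 :=
    (ContinuousLinearMap.adjoint (𝕜 := ℝ) (E := Euc 2) (F := Euc 2)).continuous.measurable.comp
      hΦ.djmeas
  have h2 : Measurable fun z : Euc 2 × Ω => v (Φ z.2 z.1) := hv.measurable.comp hΦ.jmeas
  have h3 : Continuous fun w : (Euc 2 →L[ℝ] Euc 2) × Euc 2 => w.1 w.2 :=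
    continuous_fst.clm_apply continuous_snd
  exact h3.measurable.comp (h1.prodMk h2)

lemma Hcont {v : Euc 2 → Euc 2} (hv : Continuous v) (ω : Ω) :
    Continuous fun x => tJac (Φ ω) x (v (Φ ω x)) := by
  have h1 : Continuous fun x => tJac (Φ ω) x :=
    (ContinuousLinearMap.adjoint (𝕜 := ℝ) (E := Euc 2) (F := Euc 2)).continuous.comp
      ((hΦ.c1 ω).continuous_fderiv one_ne_zero)
  exact h1.clm_apply (hv.comp (hΦ.c1 ω).continuous)

lemma Hbd {v : Euc 2 → Euc 2} {B : ℝ} (hB : ∀ x, ‖v x‖ ≤ B) (ω : Ω) (x : Euc 2) :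
    ‖tJac (Φ ω) x (v (Φ ω x))‖ ≤ C * B := by
  have h1 : ‖tJac (Φ ω) x‖ ≤ C := by
    rw [tJac, LinearIsometryEquiv.norm_map]; exact hΦ.bd ω x
  exact (ContinuousLinearMap.le_of_opNorm_le _ h1 _).trans
    (mul_le_mul_of_nonneg_left (hB _) ((norm_nonneg _).trans h1))

lemma Hdiff {v : Euc 2 → Euc 2} {B K : ℝ} (hB : ∀ x, ‖v x‖ ≤ B)
    (hK : ∀ x y, ‖v x - v y‖ ≤ K * ‖x - y‖) (hK0 : 0 ≤ K) (ω : Ω) (x h : Euc 2) :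
    ‖tJac (Φ ω) (x + h) (v (Φ ω (x + h))) - tJac (Φ ω) x (v (Φ ω x))‖ ≤
      B * ‖fderiv ℝ (Φ ω) (x + h) - fderiv ℝ (Φ ω) x‖ + C ^ 2 * K * ‖h‖ := by
  have hC : 0 ≤ C := (norm_nonneg _).trans (hΦ.bd ω x)
  have h1 : ‖tJac (Φ ω) x‖ ≤ C := by
    rw [tJac, LinearIsometryEquiv.norm_map]; exact hΦ.bd ω x
  have h2 : ‖tJac (Φ ω) (x + h) - tJac (Φ ω) x‖ = ‖fderiv ℝ (Φ ω) (x + h) - fderiv ℝ (Φ ω) x‖ := by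
    rw [tJac, tJac, ← map_sub, LinearIsometryEquiv.norm_map]
  have h3 : ‖Φ ω (x + h) - Φ ω x‖ ≤ C * ‖h‖ := by
    have := Convex.norm_image_sub_le_of_norm_fderiv_le (𝕜 := ℝ) (s := univ)
      (fun z _ => (hΦ.c1 ω).differentiable one_ne_zero z)
      (fun z _ => hΦ.bd ω z) convex_univ (mem_univ x) (mem_univ (x + h))
    simpa using this
  have h4 : tJac (Φ ω) (x + h) (v (Φ ω (x + h))) - tJac (Φ ω) x (v (Φ ω x)) =
      (tJac (Φ ω) (x + h) - tJac (Φ ω) x) (v (Φ ω (x + h))) +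
        tJac (Φ ω) x (v (Φ ω (x + h)) - v (Φ ω x)) := by
    simp
  rw [h4]
  refine (norm_add_le _ _).trans (add_le_add ?_ ?_)
  · refine (ContinuousLinearMap.le_opNorm _ _).trans ?_
    rw [h2, mul_comm]
    exact mul_le_mul_of_nonneg_right (hB _) (norm_nonneg _)
  · refine (ContinuousLinearMap.le_of_opNorm_le _ h1 _).trans ?_
    calc _ ≤ C * (K * (C * ‖h‖)) := by
          refine mul_le_mul_of_nonneg_left ((hK _ _).trans ?_) hC
          exact mul_le_mul_of_nonneg_left h3 hK0
      _ = _ := by ring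

variable (μ : Measure Ω) [IsProbabilityMeasure μ]

lemma Hint {v : Euc 2 → Euc 2} (hv : Continuous v) {B : ℝ} (hB : ∀ x, ‖v x‖ ≤ B) (x : Euc 2) :
    Integrable (fun ω => tJac (Φ ω) x (v (Φ ω x))) μ :=
  Integrable.of_bound ((hΦ.Hmeas hv).comp measurable_prodMk_left).aestronglyMeasurable (C * B)
    (ae_of_all _ fun ω => hΦ.Hbd hB ω x)

lemma fcont {v : Euc 2 → Euc 2} (hv : Continuous v) {B : ℝ} (hB : ∀ x, ‖v x‖ ≤ B) :
    Continuous fun x => ∫ ω, tJac (Φ ω) x (v (Φ ω x)) ∂μ :=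
  continuous_of_dominated (fun x => (hΦ.Hint μ hv hB x).aestronglyMeasurable)
    (fun x => ae_of_all _ fun ω => hΦ.Hbd hB ω x) (integrable_const (C * B))
    (ae_of_all _ fun ω => hΦ.Hcont hv ω)

lemma fdq {v : Euc 2 → Euc 2} (hv : Continuous v) {B K : ℝ} (hB : ∀ x, ‖v x‖ ≤ B)
    (hK : ∀ x y, ‖v x - v y‖ ≤ K * ‖x - y‖) (hK0 : 0 ≤ K) (A : Set (Euc 2)) (h : Euc 2) :
    ∫⁻ x in A, ‖(∫ ω, tJac (Φ ω) (x + h) (v (Φ ω (x + h))) ∂μ) -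
        ∫ ω, tJac (Φ ω) x (v (Φ ω x)) ∂μ‖ₑ ≤
      ‖h‖ₑ * (ENNReal.ofReal B * D * volume A ^ (1 - 1 / p) +
        ENNReal.ofReal (C ^ 2 * K) * volume A) := by
  have hB0 : 0 ≤ B := (norm_nonneg _).trans (hB 0)
  have hm := hΦ.Hmeas hv
  have hm2 : Measurable fun z : Euc 2 × Ω => ‖tJac (Φ z.2) (z.1 + h) (v (Φ z.2 (z.1 + h))) -
      tJac (Φ z.2) z.1 (v (Φ z.2 z.1))‖ₑ := by
    have : Measurable fun z : Euc 2 × Ω => (z.1 + h, z.2) := by fun_prop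
    exact ((hm.comp this).sub hm).enorm
  calc _ ≤ ∫⁻ x in A, ∫⁻ ω, ‖tJac (Φ ω) (x + h) (v (Φ ω (x + h))) - tJac (Φ ω) x (v (Φ ω x))‖ₑ ∂μ := by
        refine lintegral_mono fun x => ?_
        rw [← integral_sub (hΦ.Hint μ hv hB _) (hΦ.Hint μ hv hB _)]
        exact enorm_integral_le_lintegral_enorm _
    _ = ∫⁻ ω, (∫⁻ x in A, ‖tJac (Φ ω) (x + h) (v (Φ ω (x + h))) - tJac (Φ ω) x (v (Φ ω x))‖ₑ) ∂μ :=
        lintegral_lintegral_swap hm2.aemeasurable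
    _ ≤ ∫⁻ _, ‖h‖ₑ * (ENNReal.ofReal B * D * volume A ^ (1 - 1 / p) +
        ENNReal.ofReal (C ^ 2 * K) * volume A) ∂μ := by
        refine lintegral_mono fun ω => ?_
        calc _ ≤ ∫⁻ x in A, (ENNReal.ofReal B * ‖fderiv ℝ (Φ ω) (x + h) - fderiv ℝ (Φ ω) x‖ₑ +
                ENNReal.ofReal (C ^ 2 * K) * ‖h‖ₑ) := by
              refine lintegral_mono fun x => ?_
              rw [← ofReal_norm, ← ofReal_norm, ← ofReal_norm, ← ENNReal.ofReal_mul hB0,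
                ← ENNReal.ofReal_mul (by positivity),
                ← ENNReal.ofReal_add (by positivity) (by positivity)]
              exact ENNReal.ofReal_le_ofReal (hΦ.Hdiff hB hK hK0 ω x h)
          _ = ENNReal.ofReal B * (∫⁻ x in A, ‖fderiv ℝ (Φ ω) (x + h) - fderiv ℝ (Φ ω) x‖ₑ) +
                ENNReal.ofReal (C ^ 2 * K) * ‖h‖ₑ * volume A := by
              rw [lintegral_add_right _ measurable_const, lintegral_const_mul' _ _ (by simp),
                setLIntegral_const]
          _ ≤ ENNReal.ofReal B * (‖h‖ₑ * (D * volume A ^ (1 - 1 / p))) +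
                ENNReal.ofReal (C ^ 2 * K) * ‖h‖ₑ * volume A := by
              gcongr; exact hΦ.dq ω A h
          _ = _ := by ring
    _ = _ := by simp

lemma curl_int {k : Euc 2 → ℝ} (hk : Continuous k) {B : ℝ} (hB : ∀ x, ‖k x‖ ≤ B) (x : Euc 2) :
    Integrable (fun ω => k (Φ ω x)) μ :=
  Integrable.of_bound (hk.measurable.comp (hΦ.meas x)).aestronglyMeasurable B
    (ae_of_all _ fun ω => hB _)

lemma curl_cont {k : Euc 2 → ℝ} (hk : Continuous k) {B : ℝ} (hB : ∀ x, ‖k x‖ ≤ B) :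
    Continuous fun x => ∫ ω, k (Φ ω x) ∂μ :=
  continuous_of_dominated (fun x => (hΦ.curl_int μ hk hB x).aestronglyMeasurable)
    (fun x => ae_of_all _ fun ω => hB _) (integrable_const B)
    (ae_of_all _ fun ω => hk.comp (hΦ.c1 ω).continuous)

omit hΦ in
/-- Integrability on the product of a bounded function times a compactly supported one. -/
lemma prod_int {w : Euc 2 → ℝ} (hw : Continuous w) (hc : HasCompactSupport w) {H : Euc 2 × Ω → ℝ}
    (hH : Measurable H) {B : ℝ} (hB : ∀ z, ‖H z‖ ≤ B) :
    Integrable (fun z : Euc 2 × Ω => w z.1 * H z) (volume.prod μ) := by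
  have h1 : Integrable (fun z : Euc 2 × Ω => w z.1) (volume.prod μ) :=
    (hw.integrable_of_hasCompactSupport hc).comp_fst μ
  exact h1.mul_bdd hH.aestronglyMeasurable (ae_of_all _ hB)

lemma wcurl_f {v : Euc 2 → Euc 2} (hv : ContDiff ℝ 1 v) {B B' : ℝ} (hB : ∀ x, ‖v x‖ ≤ B)
    (hB' : ∀ x, ‖curl2 v x‖ ≤ B') (hcv : Continuous (curl2 v))
    {ψ : Euc 2 → ℝ} (hψ : ContDiff ℝ 1 ψ) (hc : HasCompactSupport ψ) :
    wcurl (fun x => ∫ ω, tJac (Φ ω) x (v (Φ ω x)) ∂μ) ψ =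
      - ∫ x, ψ x * ∫ ω, curl2 v (Φ ω x) ∂μ := by
  have hm := hΦ.Hmeas hv.continuous
  have hpi : ∀ i : Fin 2, Measurable fun z : Euc 2 × Ω => tJac (Φ z.2) z.1 (v (Φ z.2 z.1)) i :=
    fun i => (EuclideanSpace.proj i : Euc 2 →L[ℝ] ℝ).continuous.measurable.comp hm
  have hpb : ∀ (i : Fin 2) (z : Euc 2 × Ω), ‖tJac (Φ z.2) z.1 (v (Φ z.2 z.1)) i‖ ≤ C * B :=
    fun i z => (PiLp.norm_apply_le _ _).trans (hΦ.Hbd hB z.2 z.1)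
  have hcoord : ∀ x (i : Fin 2), (∫ ω, tJac (Φ ω) x (v (Φ ω x)) ∂μ) i =
      ∫ ω, tJac (Φ ω) x (v (Φ ω x)) i ∂μ := fun x i =>
    ((EuclideanSpace.proj i : Euc 2 →L[ℝ] ℝ).integral_comp_comm
      (hΦ.Hint μ hv.continuous hB x)).symm
  have hii : ∀ x (i : Fin 2), Integrable (fun ω => tJac (Φ ω) x (v (Φ ω x)) i) μ := fun x i =>
    (EuclideanSpace.proj i : Euc 2 →L[ℝ] ℝ).integrable_comp (hΦ.Hint μ hv.continuous hB x)
  have hI := (prod_int μ (vr_cont_fd hψ (ee 0)) (hc.fderiv_apply (𝕜 := ℝ) _) (hpi 1) (hpb 1)).sub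
    (prod_int μ (vr_cont_fd hψ (ee 1)) (hc.fderiv_apply (𝕜 := ℝ) _) (hpi 0) (hpb 0))
  have hJ := prod_int μ hψ.continuous hc (H := fun z : Euc 2 × Ω => curl2 v (Φ z.2 z.1))
    (hcv.measurable.comp hΦ.jmeas) (fun z => hB' _)
  calc wcurl (fun x => ∫ ω, tJac (Φ ω) x (v (Φ ω x)) ∂μ) ψ
      = ∫ x, ∫ ω, (fderiv ℝ ψ x (ee 0) * tJac (Φ ω) x (v (Φ ω x)) 1 -
          fderiv ℝ ψ x (ee 1) * tJac (Φ ω) x (v (Φ ω x)) 0) ∂μ := by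
        rw [wcurl]
        congr 1; funext x
        rw [hcoord, hcoord, integral_sub ((hii x 1).const_mul _) ((hii x 0).const_mul _),
          integral_const_mul, integral_const_mul]
    _ = ∫ ω, (∫ x, (fderiv ℝ ψ x (ee 0) * tJac (Φ ω) x (v (Φ ω x)) 1 -
          fderiv ℝ ψ x (ee 1) * tJac (Φ ω) x (v (Φ ω x)) 0)) ∂μ :=
        integral_integral_swap hI
    _ = ∫ ω, (- ∫ x, ψ x * curl2 v (Φ ω x)) ∂μ := by
        congr 1; funext ω
        rw [vr_weak_curl (hΦ.c1 ω) hv hψ hc]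
        simp only [hΦ.det, one_mul]
    _ = - ∫ x, ∫ ω, ψ x * curl2 v (Φ ω x) ∂μ := by
        rw [integral_neg]
        congr 1
        exact (integral_integral_swap (f := fun x ω => ψ x * curl2 v (Φ ω x)) hJ).symm
    _ = _ := by simp only [integral_const_mul]

end FlowFamily

lemma wcurl_c1 {v : Euc 2 → Euc 2} (hv : ContDiff ℝ 1 v)
    {ψ : Euc 2 → ℝ} (hψ : ContDiff ℝ 1 ψ) (hc : HasCompactSupport ψ) :
    wcurl v ψ = - ∫ x, ψ x * curl2 v x := by
  have h := vr_weak_curl (φ := id) contDiff_id hv hψ hc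
  have h1 : ∀ x w, tJac (d := 2) id x w = w := fun x w => by
    rw [tJac, fderiv_id]
    have : ContinuousLinearMap.adjoint (ContinuousLinearMap.id ℝ (Euc 2)) =
      ContinuousLinearMap.id ℝ (Euc 2) := ContinuousLinearMap.adjoint_id
    rw [this]; rfl
  have h2 : jdet (ContinuousLinearMap.id ℝ (Euc 2)) = 1 := by simp [jdet, ee]
  simp only [h1, fderiv_id, h2, one_mul, id] at h
  exact h

lemma curl2_cont {v : Euc 2 → Euc 2} (hv : ContDiff ℝ 1 v) : Continuous (curl2 v) :=
  (vr_coord_cont (vr_cont_fd hv (ee 0)) 1).sub (vr_coord_cont (vr_cont_fd hv (ee 1)) 0)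

lemma curl2_bd {v : Euc 2 → Euc 2} {K : ℝ} (hK : ∀ x, ‖fderiv ℝ v x‖ ≤ K) (x : Euc 2) :
    ‖curl2 v x‖ ≤ K + K := by
  have h : ∀ i j : Fin 2, ‖fderiv ℝ v x (ee i) j‖ ≤ K := fun i j => by
    refine (PiLp.norm_apply_le _ _).trans ?_
    refine (ContinuousLinearMap.le_of_opNorm_le _ (hK x) _).trans ?_
    simp [ee]
  exact (norm_sub_le _ _).trans (add_le_add (h _ _) (h _ _))

lemma vr_lip {v : Euc 2 → Euc 2} (hv : ContDiff ℝ 1 v) {K : ℝ} (hK : ∀ x, ‖fderiv ℝ v x‖ ≤ K)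
    (x y : Euc 2) : ‖v x - v y‖ ≤ K * ‖x - y‖ :=
  Convex.norm_image_sub_le_of_norm_fderiv_le (𝕜 := ℝ) (s := univ)
    (fun z _ => hv.differentiable one_ne_zero z) (fun z _ => hK z) convex_univ
    (mem_univ _) (mem_univ _)

theorem FlowFamily.repr {Ω : Type*} [MeasurableSpace Ω] {Φ : Ω → Euc 2 → Euc 2} {C p : ℝ} {D : ℝ≥0∞}
    (hΦ : FlowFamily Φ C p D) (hD : D ≠ ∞) (hp : 1 < p) (μ : Measure Ω) [IsProbabilityMeasure μ]
    {v u : Euc 2 → Euc 2} (hv : ContDiff ℝ 1 v) (hu : ContDiff ℝ 1 u) {B K K' : ℝ}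
    (hB : ∀ x, ‖v x‖ ≤ B) (hK : ∀ x, ‖fderiv ℝ v x‖ ≤ K) (hK' : ∀ x, ‖fderiv ℝ u x‖ ≤ K')
    {q : Euc 2 → ℝ} (hq : ∀ x, ∫ ω, tJac (Φ ω) x (v (Φ ω x)) ∂μ = u x + gradient q x) (x : Euc 2) :
    curl2 u x = ∫ ω, curl2 v (Φ ω x) ∂μ := by
  have hK0 : 0 ≤ K := (norm_nonneg _).trans (hK 0)
  have hK0' : 0 ≤ K' := (norm_nonneg _).trans (hK' 0)
  have hvc := hv.continuous
  set f := fun x => ∫ ω, tJac (Φ ω) x (v (Φ ω x)) ∂μ with hf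
  have hfc : Continuous f := hΦ.fcont μ hvc hB
  have hgc : Continuous fun x => f x - u x := hfc.sub hu.continuous
  set m : ℝ≥0∞ → ℝ≥0∞ := fun s => ENNReal.ofReal B * D * s ^ (1 - 1 / p) +
        ENNReal.ofReal (C ^ 2 * K) * s + ENNReal.ofReal K' * s with hm
  have hm0 : Tendsto m (𝓝 0) (𝓝 0) := by
    have hpp : 0 < 1 - 1 / p := by
      rw [sub_pos, div_lt_one (by linarith)]; exact hp
    have h1 : Tendsto (fun s : ℝ≥0∞ => s ^ (1 - 1 / p)) (𝓝 0) (𝓝 0) := by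
      have := (ENNReal.continuous_rpow_const (y := 1 - 1 / p)).tendsto 0
      rw [ENNReal.zero_rpow_of_pos hpp] at this
      exact this
    have h2 := ENNReal.Tendsto.const_mul h1 (a := ENNReal.ofReal B * D)
      (Or.inr (ENNReal.mul_ne_top ENNReal.ofReal_ne_top hD))
    have h3 := ENNReal.Tendsto.const_mul (tendsto_id (x := 𝓝 (0:ℝ≥0∞)))
      (a := ENNReal.ofReal (C ^ 2 * K)) (Or.inr ENNReal.ofReal_ne_top)
    have h4 := ENNReal.Tendsto.const_mul (tendsto_id (x := 𝓝 (0:ℝ≥0∞)))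
      (a := ENNReal.ofReal K') (Or.inr ENNReal.ofReal_ne_top)
    have h5 := (h2.add h3).add h4
    simp only [mul_zero, add_zero, id] at h5
    exact h5
  have hgrad : ∀ x, f x - u x = gradient q x := fun x => by rw [hf]; simp only [hq x]; abel
  have hdq : ∀ A, MeasurableSet A → ∀ t ∈ Ioc (0:ℝ) 1, ∀ i : Fin 2,
      ∫⁻ x in A, ‖(f (x + t • ee i) - u (x + t • ee i)) - (f x - u x)‖ₑ ≤
        ENNReal.ofReal t * m (volume A) := by
    intro A _ t ht i
    have hn : ‖t • (ee i : Euc 2)‖ₑ = ENNReal.ofReal t := by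
      rw [← ofReal_norm, norm_smul, Real.norm_of_nonneg ht.1.le]; simp [ee]
    calc _ ≤ ∫⁻ x in A, (‖f (x + t • ee i) - f x‖ₑ + ENNReal.ofReal K' * ENNReal.ofReal t) := by
          refine lintegral_mono fun x => ?_
          have : (f (x + t • ee i) - u (x + t • ee i)) - (f x - u x) =
            (f (x + t • ee i) - f x) - (u (x + t • ee i) - u x) := by abel
          rw [this]
          refine (enorm_sub_le).trans (add_le_add le_rfl ?_)
          rw [← hn, ← ofReal_norm, ← ofReal_norm, ← ENNReal.ofReal_mul hK0']
          refine ENNReal.ofReal_le_ofReal ?_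
          simpa using vr_lip hu hK' (x + t • ee i) x
      _ = (∫⁻ x in A, ‖f (x + t • ee i) - f x‖ₑ) +
            ENNReal.ofReal K' * ENNReal.ofReal t * volume A := by
          rw [lintegral_add_right _ measurable_const, setLIntegral_const]
      _ ≤ ‖t • (ee i : Euc 2)‖ₑ * (ENNReal.ofReal B * D * volume A ^ (1 - 1 / p) +
            ENNReal.ofReal (C ^ 2 * K) * volume A) +
            ENNReal.ofReal K' * ENNReal.ofReal t * volume A := by
          gcongr
          exact hΦ.fdq μ hvc hB (vr_lip hv hK) hK0 A _
      _ = _ := by rw [hn, hm]; ring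
  have hzero : ∀ ψ : Euc 2 → ℝ, ContDiff ℝ 1 ψ → HasCompactSupport ψ →
      ∫ x, ψ x * curl2 u x = ∫ x, ψ x * ∫ ω, curl2 v (Φ ω x) ∂μ := by
    intro ψ hψ hc
    have h0 := vr_gradient_wcurl hgc hm0 hdq hgrad hψ hc
    have h1 : wcurl (fun x => f x - u x) ψ = wcurl f ψ - wcurl u ψ := by
      rw [wcurl_eq hgc hψ hc, wcurl_eq hfc hψ hc, wcurl_eq hu.continuous hψ hc]
      simp only [PiLp.sub_apply, mul_sub]
      rw [integral_sub (vr_int_fd (vr_coord_cont hfc 1) hψ hc _)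
        (vr_int_fd (vr_coord_cont hu.continuous 1) hψ hc _),
        integral_sub (vr_int_fd (vr_coord_cont hfc 0) hψ hc _)
        (vr_int_fd (vr_coord_cont hu.continuous 0) hψ hc _)]
      ring
    rw [h1, hΦ.wcurl_f μ hv hB (curl2_bd hK) (curl2_cont hv) hψ hc, wcurl_c1 hu hψ hc] at h0
    linarith
  have hEc := hΦ.curl_cont μ (curl2_cont hv) (curl2_bd hK)
  have hae : curl2 u =ᵐ[volume] fun x => ∫ ω, curl2 v (Φ ω x) ∂μ := by
    refine ae_eq_of_integral_contDiff_smul_eq (curl2_cont hu).locallyIntegrable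
      hEc.locallyIntegrable fun ψ hψ hc => ?_
    simpa [smul_eq_mul] using hzero ψ (hψ.of_le (by simp)) hc
  exact congrFun (((curl2_cont hu).ae_eq_iff_eq volume hEc).1 hae) x

theorem FlowFamily.lq {Ω : Type*} [MeasurableSpace Ω] {Φ : Ω → Euc 2 → Euc 2} {C p : ℝ} {D : ℝ≥0∞}
    (hΦ : FlowFamily Φ C p D) (μ : Measure Ω) [IsProbabilityMeasure μ]
    {k : Euc 2 → ℝ} (hk : Continuous k) {q : ℝ≥0∞} (hq : 1 ≤ q) :
    eLpNorm (fun x => ∫ ω, k (Φ ω x) ∂μ) q volume ≤ eLpNorm k q volume := by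
  rcases eq_or_ne q ∞ with rfl | hqt
  · have hall : ∀ x, ‖k x‖ₑ ≤ eLpNorm k ∞ volume := by
      have hae : ∀ᵐ x, ‖k x‖ₑ ≤ eLpNorm k ∞ volume := by
        rw [eLpNorm_exponent_top]; exact ae_le_eLpNormEssSup
      have hop : IsOpen {x | eLpNorm k ∞ volume < ‖k x‖ₑ} :=
        isOpen_lt continuous_const hk.enorm
      have := hop.eq_empty_of_measure_zero (μ := volume) (by
        rw [ae_iff] at hae; simpa using hae)
      intro x
      by_contra hx
      exact (this ▸ (not_le.1 hx : x ∈ {x | eLpNorm k ∞ volume < ‖k x‖ₑ}) : x ∈ (∅ : Set (Euc 2)))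
    conv_lhs => rw [eLpNorm_exponent_top]
    refine eLpNormEssSup_le_of_ae_enorm_bound (ae_of_all _ fun x => ?_)
    refine (enorm_integral_le_lintegral_enorm _).trans ?_
    calc _ ≤ ∫⁻ _, eLpNorm k ∞ volume ∂μ := lintegral_mono fun ω => hall _
      _ = _ := by simp
  · have hq0 : q ≠ 0 := (zero_lt_one.trans_le hq).ne'
    set s := q.toReal with hs
    have hs1 : 1 ≤ s := by
      rw [hs, ← ENNReal.toReal_one]; exact ENNReal.toReal_mono hqt hq
    have hs0 : 0 < s := by linarith
    have hpt : ∀ x, ‖∫ ω, k (Φ ω x) ∂μ‖ₑ ^ s ≤ ∫⁻ ω, ‖k (Φ ω x)‖ₑ ^ s ∂μ := by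
      intro x
      have hmeas : AEStronglyMeasurable (fun ω => k (Φ ω x)) μ :=
        (hk.measurable.comp (hΦ.meas x)).aestronglyMeasurable
      have h1 := eLpNorm_le_eLpNorm_of_exponent_le hq hmeas
      rw [eLpNorm_one_eq_lintegral_enorm, eLpNorm_eq_lintegral_rpow_enorm_toReal hq0 hqt,
        ← hs] at h1
      have h2 := (enorm_integral_le_lintegral_enorm (μ := μ) (fun ω => k (Φ ω x))).trans h1
      have h3 := ENNReal.rpow_le_rpow h2 hs0.le
      rwa [← ENNReal.rpow_mul, one_div, inv_mul_cancel₀ hs0.ne', ENNReal.rpow_one] at h3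
    rw [eLpNorm_eq_lintegral_rpow_enorm_toReal hq0 hqt, eLpNorm_eq_lintegral_rpow_enorm_toReal hq0 hqt]
    refine ENNReal.rpow_le_rpow ?_ (by positivity)
    have hm : Measurable fun z : Euc 2 × Ω => ‖k (Φ z.2 z.1)‖ₑ ^ s :=
      (hk.measurable.comp hΦ.jmeas).enorm.pow_const s
    calc _ ≤ ∫⁻ x, ∫⁻ ω, ‖k (Φ ω x)‖ₑ ^ s ∂μ := lintegral_mono hpt
      _ = ∫⁻ ω, (∫⁻ x, ‖k (Φ ω x)‖ₑ ^ s) ∂μ := lintegral_lintegral_swap hm.aemeasurable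
      _ ≤ ∫⁻ _, (∫⁻ x, ‖k x‖ₑ ^ s) ∂μ := lintegral_mono fun ω =>
          vr_measure_le (hΦ.c1 ω) (hΦ.inj ω) (hΦ.det ω) (fun x => ‖k x‖ₑ ^ s)
      _ = _ := by rw [lintegral_const, measure_univ, mul_one]

/-! ## Part 9 -/
lemma wNorm_two (p : ℝ) (f : Euc 2 → Euc 2) : wNorm 0 2 p f =
    eLpNorm f (ENNReal.ofReal p) volume + eLpNorm (fderiv ℝ f) (ENNReal.ofReal p) volume +
      eLpNorm (fderiv ℝ (fderiv ℝ f)) (ENNReal.ofReal p) volume := by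
  have h : Finset.Icc 0 2 = {0, 1, 2} := by decide
  rw [wNorm, h, Finset.sum_insert (by decide), Finset.sum_insert (by decide),
    Finset.sum_singleton, ← add_assoc]
  congr 1
  · congr 1
    · exact eLpNorm_congr_norm_ae (ae_of_all _ fun x => by simp)
    · exact eLpNorm_congr_norm_ae (ae_of_all _ fun x => norm_iteratedFDeriv_one f)
  · have h2 : ∀ x, ‖iteratedFDeriv ℝ 2 f x‖ = ‖fderiv ℝ (fderiv ℝ f) x‖ := fun x => by
      rw [← norm_iteratedFDeriv_one (𝕜 := ℝ) (fderiv ℝ f), norm_iteratedFDeriv_fderiv]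
    rw [← eLpNorm_norm, ← eLpNorm_norm (fderiv ℝ (fderiv ℝ f))]
    simp only [h2]

lemma vr_sup2 (p : ℝ) (hp : 2 < p) : ∃ C : ℝ≥0, ∀ f : Euc 2 → Euc 2, ContDiff ℝ 2 f → ∀ x,
    ‖f x‖ₑ ≤ C * wNorm 0 2 p f ∧ ‖fderiv ℝ f x‖ₑ ≤ C * wNorm 0 2 p f := by
  obtain ⟨C1, h1⟩ := vr_morrey (F := Euc 2) p hp
  obtain ⟨C2, h2⟩ := vr_morrey (F := Euc 2 →L[ℝ] Euc 2) p hp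
  refine ⟨C1 + C2, fun f hf x => ⟨?_, ?_⟩⟩
  · refine (h1 f (hf.of_le (by norm_num)) x).trans ?_
    rw [wNorm_two]
    exact mul_le_mul' (by simp) le_self_add
  · refine (h2 _ (hf.fderiv_right (m := 1) (by norm_num)) x).trans ?_
    rw [wNorm_two]
    rw [add_assoc]
    exact mul_le_mul' (by simp) le_add_self

lemma wNorm_le {p : ℝ} (hp : 1 ≤ p) {f g : Euc 2 → Euc 2} (hf : ContDiff ℝ 2 f) (hg : ContDiff ℝ 2 g) :
    wNorm 0 2 p f ≤ wNorm 0 2 p (fun x => f x - g x) + wNorm 0 2 p g := by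
  rw [wNorm, wNorm, wNorm, ← Finset.sum_add_distrib]
  refine Finset.sum_le_sum fun j hj => ?_
  have hj2 : ((j : ℕ) : WithTop ℕ∞) ≤ 2 := by exact_mod_cast (Finset.mem_Icc.1 hj).2
  have hsub : ContDiff ℝ 2 fun x => f x - g x := hf.sub hg
  have he : iteratedFDeriv ℝ j f = iteratedFDeriv ℝ j (fun x => f x - g x) + iteratedFDeriv ℝ j g := by
    rw [← iteratedFDeriv_add (hsub.of_le hj2) (hg.of_le hj2)]
    congr 1
    funext x
    simp
  rw [he]
  exact eLpNorm_add_le (hsub.continuous_iteratedFDeriv hj2).aestronglyMeasurable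
    (hg.continuous_iteratedFDeriv hj2).aestronglyMeasurable (by simpa using hp)

lemma vr_joint {F : Type*} [NormedAddCommGroup F] {G : ℝ → Euc 2 → F} (hG : ∀ r, Continuous (G r))
    (h : ∀ r₀, ∃ e : ℝ → ℝ≥0∞, Tendsto e (𝓝 r₀) (𝓝 0) ∧ ∀ r x, ‖G r x - G r₀ x‖ₑ ≤ e r) :
    Continuous (Function.uncurry G) := by
  rw [continuous_iff_continuousAt]
  rintro ⟨r₀, x₀⟩
  obtain ⟨e, he, hb⟩ := h r₀
  rw [ContinuousAt, tendsto_iff_edist_tendsto_0]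
  have h1 : Tendsto (fun z : ℝ × Euc 2 => e z.1) (𝓝 (r₀, x₀)) (𝓝 0) :=
    he.comp (continuous_fst.tendsto (r₀, x₀))
  have h2 : Tendsto (fun z : ℝ × Euc 2 => edist (G r₀ z.2) (G r₀ x₀)) (𝓝 (r₀, x₀)) (𝓝 0) := by
    have := ((hG r₀).comp continuous_snd).tendsto (r₀, x₀)
    exact tendsto_iff_edist_tendsto_0.1 this
  have h3 := h1.add h2
  rw [add_zero] at h3
  refine tendsto_of_tendsto_of_tendsto_of_le_of_le tendsto_const_nhds h3 (fun _ => zero_le) ?_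
  rintro ⟨r, x⟩
  refine (edist_triangle _ (G r₀ x) _).trans (add_le_add ?_ le_rfl)
  rw [edist_eq_enorm_sub]
  exact hb r x

lemma vr_field {u : ℝ → Euc 2 → Euc 2} {p T : ℝ} (hp : 2 < p) (hT : 0 < T)
    (hu : ∀ t ∈ Icc (-T) (0:ℝ), ContDiff ℝ 2 (u t) ∧ wNorm 0 2 p (u t) < ∞)
    (hc : ∀ t₀ ∈ Icc (-T) (0:ℝ),
      Tendsto (fun t => wNorm 0 2 p (fun x => u t x - u t₀ x)) (𝓝[Icc (-T) 0] t₀) (𝓝 0))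
    (hd : ∀ t ∈ Icc (-T) (0:ℝ), ∀ x, divg (u t) x = 0) :
    ∃ L M : ℝ, ∃ D : ℝ≥0∞, D ≠ ∞ ∧ GoodField (fun r => u (max (-T) (min r 0))) L ∧
      (∀ r x, ‖u (max (-T) (min r 0)) x‖ ≤ M) ∧
      ∀ r, eLpNorm (fderiv ℝ (fderiv ℝ (u (max (-T) (min r 0))))) (ENNReal.ofReal p) volume ≤ D := by
  obtain ⟨C, hC⟩ := vr_sup2 p hp
  have hmem : ∀ r, max (-T) (min r 0) ∈ Icc (-T) (0:ℝ) := fun r =>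
    ⟨le_max_left _ _, max_le (by linarith) (min_le_right _ _)⟩
  have hcl : Continuous fun r : ℝ => max (-T) (min r 0) := by fun_prop
  have hbound : ∃ D : ℝ≥0∞, D ≠ ∞ ∧ ∀ t ∈ Icc (-T) (0:ℝ), wNorm 0 2 p (u t) ≤ D := by
    refine isCompact_Icc.induction_on
      (p := fun s => ∃ D : ℝ≥0∞, D ≠ ∞ ∧ ∀ t ∈ s, wNorm 0 2 p (u t) ≤ D) ⟨0, by simp, by simp⟩ ?_ ?_ ?_
    · rintro s t hst ⟨D, hD, h⟩
      exact ⟨D, hD, fun x hx => h x (hst hx)⟩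
    · rintro s t ⟨D, hD, h⟩ ⟨D', hD', h'⟩
      refine ⟨D + D', by simp [hD, hD'], fun x hx => ?_⟩
      rcases hx with hx | hx
      · exact (h x hx).trans le_self_add
      · exact (h' x hx).trans le_add_self
    · intro t₀ ht₀
      have h1 := (hc t₀ ht₀).eventually (gt_mem_nhds (zero_lt_one))
      refine ⟨_, inter_mem h1 self_mem_nhdsWithin, 1 + wNorm 0 2 p (u t₀), by
        simp [(hu t₀ ht₀).2.ne], fun t ht => ?_⟩
      refine (wNorm_le (by linarith) (hu t ht.2).1 (hu t₀ ht₀).1).trans ?_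
      gcongr
      exact (show _ < _ from ht.1).le
  obtain ⟨D, hD, hDb⟩ := hbound
  have hctv : ∀ r₀ : ℝ, Tendsto (fun r : ℝ => C * wNorm 0 2 p
      (fun x => u (max (-T) (min r 0)) x - u (max (-T) (min r₀ 0)) x)) (𝓝 r₀) (𝓝 0) := by
    intro r₀
    have h1 := (hc _ (hmem r₀)).comp (tendsto_nhdsWithin_iff.2
      ⟨hcl.tendsto r₀, Eventually.of_forall fun r => hmem r⟩)
    have h2 := ENNReal.Tendsto.const_mul h1 (a := (C : ℝ≥0∞)) (Or.inr ENNReal.coe_ne_top)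
    rw [mul_zero] at h2
    exact h2
  have hfin : (C : ℝ≥0∞) * D ≠ ∞ := ENNReal.mul_ne_top ENNReal.coe_ne_top hD
  have hnorm : ∀ {F : Type} [NormedAddCommGroup F] (y : F), ‖y‖ₑ ≤ C * D → ‖y‖ ≤ (C * D).toReal + 1 := by
    intro F _ y hy
    have := ENNReal.toReal_mono hfin hy
    rw [toReal_enorm] at this
    linarith
  refine ⟨(C * D).toReal + 1, (C * D).toReal + 1, D, hD, ⟨?_, ?_, ?_, ?_, ?_, by positivity⟩, ?_, ?_⟩
  · refine vr_joint (fun r => (hu _ (hmem r)).1.continuous) fun r₀ => ⟨_, hctv r₀, fun r x => ?_⟩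
    exact (hC _ ((hu _ (hmem r)).1.sub (hu _ (hmem r₀)).1) x).1
  · exact fun r => (hu _ (hmem r)).1
  · refine vr_joint (G := fun r => fderiv ℝ (u (max (-T) (min r 0))))
      (fun r => (hu _ (hmem r)).1.continuous_fderiv (by norm_num))
      fun r₀ => ⟨_, hctv r₀, fun r x => ?_⟩
    have := (hC _ ((hu _ (hmem r)).1.sub (hu _ (hmem r₀)).1) x).2
    rwa [fderiv_fun_sub ((hu _ (hmem r)).1.differentiable (by norm_num) x)
      ((hu _ (hmem r₀)).1.differentiable (by norm_num) x)] at this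
  · intro r x
    exact hnorm _ (((hC _ (hu _ (hmem r)).1 x).2).trans (by gcongr; exact hDb _ (hmem r)))
  · exact fun r x => hd _ (hmem r) x
  · intro r x
    exact hnorm _ (((hC _ (hu _ (hmem r)).1 x).1).trans (by gcongr; exact hDb _ (hmem r)))
  · intro r
    refine le_trans ?_ (hDb _ (hmem r))
    rw [wNorm_two]
    exact le_add_self

/-- Translation of a good field along a continuous path. -/
lemma GoodField.translate {b : ℝ → Euc 2 → Euc 2} {L : ℝ} (hb : GoodField b L) {w : ℝ → Euc 2}
    (hw : Continuous w) : GoodField (fun r z => b r (z + w r)) L where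
  cont := hb.cont.comp (continuous_fst.prodMk (continuous_snd.add (hw.comp continuous_fst)))
  smooth r := (hb.smooth r).comp (contDiff_id.add contDiff_const)
  dcont := by
    simp only [fderiv_comp_add_right]
    exact hb.dcont.comp (continuous_fst.prodMk (continuous_snd.add (hw.comp continuous_fst)))
  bd r x := by
    rw [fderiv_comp_add_right]; exact hb.bd r _
  div r x := by
    have := hb.div r (x + w r)
    simp only [divg, fderiv_comp_add_right] at this ⊢
    exact this
  pos := hb.pos

lemma vr_eLp_translate {F : Type*} [NormedAddCommGroup F] (f : Euc 2 → F) {p : ℝ} (hp : 1 ≤ p)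
    (c : Euc 2) : eLpNorm (fun z => f (z + c)) (ENNReal.ofReal p) volume =
      eLpNorm f (ENNReal.ofReal p) volume := by
  rw [vr_eLpNorm_eq p hp, vr_eLpNorm_eq p hp]
  have h1 : ∫⁻ x, ‖f (x + c)‖ₑ ^ p = ∫⁻ x, ‖f x‖ₑ ^ p :=
    lintegral_add_right_eq_self (fun x => ‖f x‖ₑ ^ p) c
  rw [h1]

lemma vr_translate_D (g : Euc 2 → Euc 2) (c : Euc 2) {p : ℝ} (hp : 1 ≤ p) :
    eLpNorm (fderiv ℝ (fderiv ℝ fun z => g (z + c))) (ENNReal.ofReal p) volume =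
      eLpNorm (fderiv ℝ (fderiv ℝ g)) (ENNReal.ofReal p) volume := by
  have h1 : fderiv ℝ (fun z => g (z + c)) = fun z => fderiv ℝ g (z + c) := by
    funext z; exact fderiv_comp_add_right c
  have h2 : fderiv ℝ (fun z => fderiv ℝ g (z + c)) = fun z => fderiv ℝ (fderiv ℝ g) (z + c) := by
    funext z; exact fderiv_comp_add_right c
  rw [h1, h2]
  have h := vr_eLp_translate (fderiv ℝ (fderiv ℝ g)) hp c
  exact h

/-! ## Part 10 -/
/-- The drift along any solution of the integral equation is automatically integrable. -/
lemma vr_auto_int {v : ℝ → Euc 2 → Euc 2} (hv : Continuous (Function.uncurry v)) {M : ℝ}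
    (hM : ∀ r x, ‖v r x‖ ≤ M) {ξ w : ℝ → Euc 2} (hw : Continuous w) {x : Euc 2} {t c : ℝ} (htc : t ≤ c)
    (h : ∀ s ∈ Icc t c, ξ s = x + (∫ r in t..s, v r (ξ r)) + w s) :
    IntervalIntegrable (fun r => v r (ξ r)) volume t c := by
  set g := fun r => v r (ξ r) with hg
  have hiff : ∀ s, t ≤ s → AEStronglyMeasurable g (volume.restrict (Ioc t s)) →
      IntervalIntegrable g volume t s := fun s hs hm => by
    rw [intervalIntegrable_iff_integrableOn_Ioc_of_le hs]
    exact Integrable.of_bound hm M (ae_of_all _ fun r => hM _ _)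
  set S := {s | s ∈ Icc t c ∧ IntervalIntegrable g volume t s} with hS
  have hSn : S.Nonempty := ⟨t, ⟨le_rfl, htc⟩, by simp⟩
  have hSb : BddAbove S := ⟨c, fun s hs => hs.1.2⟩
  obtain ⟨a, -, hat, haS⟩ := exists_seq_tendsto_sSup hSn hSb
  set σ := sSup S
  have h1 : AEStronglyMeasurable g (volume.restrict (⋃ n, Ioc t (a n))) := by
    rw [aestronglyMeasurable_iUnion_iff]
    intro n
    have := (haS n).2
    rw [intervalIntegrable_iff_integrableOn_Ioc_of_le (haS n).1.1] at this
    exact this.aestronglyMeasurable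
  have h2 : AEStronglyMeasurable g (volume.restrict {σ}) := by
    have : (volume : Measure ℝ).restrict {σ} = 0 := by
      rw [Measure.restrict_eq_zero]; simp
    rw [this]; exact aestronglyMeasurable_zero_measure g
  have h3 : AEStronglyMeasurable g (volume.restrict (Ioc σ c)) := by
    have hc : Continuous fun s => v s (x + w s) :=
      hv.comp (continuous_id.prodMk (continuous_const.add hw))
    refine hc.aestronglyMeasurable.congr ?_
    refine (ae_restrict_iff' measurableSet_Ioc).2 (ae_of_all _ fun s hs => ?_)
    have hts : t ≤ σ := le_csSup hSb ⟨⟨le_rfl, htc⟩, by simp⟩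
    have hsm : s ∈ Icc t c := ⟨hts.trans hs.1.le, hs.2⟩
    have hni : ¬ IntervalIntegrable g volume t s := fun hi =>
      not_lt.2 (le_csSup hSb (show s ∈ S from ⟨hsm, hi⟩)) hs.1
    have := h s hsm
    rw [intervalIntegral.integral_undef hni, add_zero] at this
    simp only [hg, this]
  refine hiff c htc ?_
  refine AEStronglyMeasurable.mono_set (t := ((⋃ n, Ioc t (a n)) ∪ {σ}) ∪ Ioc σ c) ?_ ?_
  · intro s hs
    rcases lt_trichotomy s σ with hlt | heq | hgt
    · obtain ⟨n, hn⟩ := (hat.eventually (lt_mem_nhds hlt)).exists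
      exact Or.inl (Or.inl (mem_iUnion.2 ⟨n, hs.1, hn.le⟩))
    · exact Or.inl (Or.inr heq)
    · exact Or.inr ⟨hgt, hs.2⟩
  · rw [aestronglyMeasurable_union_iff, aestronglyMeasurable_union_iff]
    exact ⟨⟨h1, h2⟩, h3⟩

lemma vr_ident {v : ℝ → Euc 2 → Euc 2} {L : ℝ} (hv : GoodField v L) {M : ℝ}
    (hM : ∀ r x, ‖v r x‖ ≤ M) {ξ w : ℝ → Euc 2} (hw : Continuous w) {x : Euc 2} {t c : ℝ} (htc : t ≤ c)
    (h : ∀ s ∈ Icc t c, ξ s = x + (∫ r in t..s, v r (ξ r)) + w s)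
    {Z : ℝ → Euc 2 → Euc 2} (hZ : IsFlow (fun r z => v r (z + w r)) t Z) :
    ξ c = Z c x + w c := by
  have hi := vr_auto_int hv.cont hM hw htc h
  have hcl : ∀ s ∈ Icc t c, max t (min s c) = s := fun s hs => by
    rw [min_eq_left hs.2, max_eq_right hs.1]
  set y : ℝ → Euc 2 := fun s => x + ∫ r in t..(max t (min s c)), v r (ξ r) with hy
  have hyc : Continuous y := by
    refine continuous_const.add ?_
    have h1 : ContinuousOn (fun s => ∫ r in t..s, v r (ξ r)) (uIcc t c) :=
      intervalIntegral.continuousOn_primitive_interval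
        ((intervalIntegrable_iff_integrableOn_Icc_of_le htc).1 hi |>.mono_set (by rw [uIcc_of_le htc]))
    have h2 : Continuous fun s => max t (min s c) := by fun_prop
    refine h1.comp_continuous h2 fun s => ?_
    rw [uIcc_of_le htc]
    exact ⟨le_max_left _ _, max_le htc (min_le_right _ _)⟩
  have hyξ : ∀ s ∈ Icc t c, y s + w s = ξ s := fun s hs => by
    rw [h s hs]; simp only [hy, hcl s hs]
  have key := (hv.translate hw).unique hZ (y := y) (c := c) (x := x) hyc (fun s hs => by
    have : ∫ r in t..s, v r (y r + w r) = ∫ r in t..s, v r (ξ r) := by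
      refine intervalIntegral.integral_congr fun r hr => ?_
      rw [uIcc_of_le hs.1] at hr
      simp only [hyξ r ⟨hr.1, hr.2.trans hs.2⟩]
    rw [this]
    simp only [hy, hcl s hs]) c ⟨htc, le_rfl⟩
  rw [← key, hyξ c ⟨htc, le_rfl⟩]

lemma vr_pic_meas {Ω : Type*} [MeasurableSpace Ω] {v : ℝ → Euc 2 → Euc 2}
    (hv : Continuous (Function.uncurry v)) {w : Ω → ℝ → Euc 2} (hw : ∀ ω, Continuous (w ω))
    (hwm : ∀ s, Measurable fun ω => w ω s) (t : ℝ) (x : Euc 2) (n : ℕ) :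
    ∀ s, Measurable fun ω => pic (fun r z => v r (z + w ω r)) t x n s := by
  have hF : ∀ ω, Continuous (Function.uncurry fun r z => v r (z + w ω r)) := fun ω =>
    hv.comp (continuous_fst.prodMk (continuous_snd.add ((hw ω).comp continuous_fst)))
  induction n with
  | zero => intro s; exact measurable_const
  | succ n ih =>
    intro s
    have hj : Measurable (Function.uncurry fun (r : ℝ) (ω : Ω) =>
        v r (pic (fun r z => v r (z + w ω r)) t x n r + w ω r)) := by
      refine measurable_uncurry_of_continuous_of_measurable (fun ω => ?_) (fun r => ?_)
      · exact hv.comp (continuous_id.prodMk ((pic_cont (hF ω) t x n).add (hw ω)))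
      · have : Continuous (v r) := hv.comp (Continuous.prodMk_right r)
        exact this.measurable.comp ((ih r).add (hwm r))
    have hI : ∀ A : Set ℝ, Measurable fun ω => ∫ r in A,
        v r (pic (fun r z => v r (z + w ω r)) t x n r + w ω r) := fun A =>
      (StronglyMeasurable.integral_prod_left (μ := volume.restrict A) hj.stronglyMeasurable).measurable
    have := (((hI (Ioc t s)).sub (hI (Ioc s t))).const_add x)
    exact this

lemma vr_family {Ω : Type*} [MeasurableSpace Ω] {v : ℝ → Euc 2 → Euc 2} {L : ℝ} (hv : GoodField v L)
    {M : ℝ} (hM : ∀ r x, ‖v r x‖ ≤ M) {p : ℝ} (hp : 1 ≤ p) {D : ℝ≥0∞}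
    (hD : ∀ r, eLpNorm (fderiv ℝ (fderiv ℝ (v r))) (ENNReal.ofReal p) volume ≤ D)
    {w : Ω → ℝ → Euc 2} (hw : ∀ ω, Continuous (w ω))
    (hwm : ∀ s, Measurable fun ω => w ω s) {t c : ℝ} (htc : t ≤ c) :
    ∃ Φ : Ω → Euc 2 → Euc 2, FlowFamily Φ (Real.exp (L * (c - t))) p
        (ENNReal.ofReal (Real.exp (L * (c - t)) ^ 3 * (c - t)) * D) ∧
      ∀ ω (ξ : ℝ → Euc 2) x, (∀ s ∈ Icc t c, ξ s = x + (∫ r in t..s, v r (ξ r)) + w ω s) →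
        ξ c = Φ ω x := by
  have hb := fun ω => hv.translate (hw ω)
  choose Z hZ hlim using fun ω => (hb ω).exists_flow t
  have hfd : ∀ ω x, fderiv ℝ (fun x => Z ω c x + w ω c) x = fderiv ℝ (Z ω c) x := fun ω x => by
    rw [fderiv_add_const]
  refine ⟨fun ω x => Z ω c x + w ω c, ⟨?_, ?_, ?_, ?_, ?_, ?_⟩, ?_⟩
  · exact fun ω => ((hb ω).flow_contDiff (hZ ω) htc).add contDiff_const
  · exact fun ω x y hxy => (hb ω).flow_inj (hZ ω) htc (add_right_cancel hxy)
  · intro ω x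
    rw [hfd]; exact (hb ω).flow_jdet (hZ ω) htc x
  · intro ω x
    rw [hfd]; exact (hb ω).flow_fderiv_bound (hZ ω) htc x
  · intro ω A h
    simp only [hfd]
    have := (hb ω).flow_dq (hZ ω) hp (D := D) (fun r => by
      rw [vr_translate_D _ _ hp]; exact hD r) htc A h
    refine this.trans (le_of_eq ?_)
    ring
  · intro x
    refine Measurable.add ?_ (hwm c)
    refine measurable_of_tendsto_metrizable (f := fun n ω =>
      pic (fun r z => v r (z + w ω r)) t x n c) (fun n => vr_pic_meas hv.cont hw hwm t x n c) ?_
    rw [tendsto_pi_nhds]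
    exact fun ω => hlim ω x c htc
  · intro ω ξ x h
    exact vr_ident hv hM (hw ω) htc h (hZ ω)

/-- 2D vorticity representation and maximum principle. If `(u,X)`
solves the stochastic Lagrangian system on `[-T,0]` with divergence-free
`u₀ ∈ W^{2,p}(ℝ²;ℝ²)`, `p > 2`, then the vorticity `ω_t = curl u_t` satisfies
`ω_t = 𝔼[ω₀ ∘ X_{t,0}]` and hence `‖ω_t‖_q ≤ ‖ω₀‖_q` for all `1 ≤ q ≤ ∞`. -/
theorem vorticity_representation_2d (ν : ℝ) (hν : 0 ≤ ν) (p : ℝ) (hp : 2 < p)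
    (T : ℝ) (hT : 0 < T)
    {Ω : Type*} [MeasureSpace Ω] [IsProbabilityMeasure (ℙ : Measure Ω)]
    (W : ℝ → Ω → Euc 2) (hW : IsBrownianMotion W)
    (P : (Euc 2 → Euc 2) → (Euc 2 → Euc 2)) (hP : IsLerayProjection P)
    (u₀ : Euc 2 → Euc 2) (hu₀ : MemW 2 p u₀) (hdiv : ∀ x, divg u₀ x = 0)
    (u : ℝ → Euc 2 → Euc 2) (X : ℝ → ℝ → Euc 2 → Ω → Euc 2)
    (hsys : SolvesLocalSystem P W ν 0 p T u₀ u X) :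
    ∀ t ∈ Icc (-T) (0:ℝ),
      (∀ x, curl2 (u t) x = ∫ ω, curl2 u₀ (X t 0 x ω) ∂(ℙ : Measure Ω)) ∧
      (∀ q : ℝ≥0∞, 1 ≤ q →
        eLpNorm (curl2 (u t)) q volume ≤ eLpNorm (curl2 u₀) q volume) := by
  intro t ht
  obtain ⟨hX, hPu, hreg, hcont⟩ := hsys
  have hreg' : ∀ t ∈ Icc (-T) (0:ℝ), ContDiff ℝ 2 (u t) ∧ wNorm 0 2 p (u t) < ∞ := fun t ht =>
    ⟨by simpa using (hreg t ht).1, by simpa using (hreg t ht).2⟩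
  have hcont' : ∀ t₀ ∈ Icc (-T) (0:ℝ),
      Tendsto (fun t => wNorm 0 2 p (fun x => u t x - u t₀ x)) (𝓝[Icc (-T) 0] t₀) (𝓝 0) :=
    fun t₀ ht₀ => by simpa using hcont t₀ ht₀
  have hdivu : ∀ t ∈ Icc (-T) (0:ℝ), ∀ x, divg (u t) x = 0 := fun t ht x => by
    have hd := (hreg' t ht).1.differentiable (by norm_num)
    rw [hPu t ht] at hd ⊢
    exact hP.2.2.1 _ hd x
  obtain ⟨L, M, D, hD, hv, hM, hDb⟩ := vr_field hp hT hreg' hcont' hdivu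
  have hu0 : ContDiff ℝ 2 u₀ := by simpa using hu₀.1
  have hu01 : ContDiff ℝ 1 u₀ := hu0.of_le (by norm_num)
  obtain ⟨C, hC⟩ := vr_sup2 p hp
  have hfin : (C : ℝ≥0∞) * wNorm 0 2 p u₀ ≠ ∞ := ENNReal.mul_ne_top ENNReal.coe_ne_top hu₀.2.ne
  have hB : ∀ x, ‖u₀ x‖ ≤ (C * wNorm 0 2 p u₀).toReal := fun x => by
    have := ENNReal.toReal_mono hfin (hC u₀ hu0 x).1
    rwa [toReal_enorm] at this
  have hK : ∀ x, ‖fderiv ℝ u₀ x‖ ≤ (C * wNorm 0 2 p u₀).toReal := fun x => by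
    have := ENNReal.toReal_mono hfin (hC u₀ hu0 x).2
    rwa [toReal_enorm] at this
  have hfint : (C : ℝ≥0∞) * wNorm 0 2 p (u t) ≠ ∞ :=
    ENNReal.mul_ne_top ENNReal.coe_ne_top (hreg' t ht).2.ne
  have hKt : ∀ x, ‖fderiv ℝ (u t) x‖ ≤ (C * wNorm 0 2 p (u t)).toReal := fun x => by
    have := ENNReal.toReal_mono hfint (hC (u t) (hreg' t ht).1 x).2
    rwa [toReal_enorm] at this
  -- a measurable set of good scenarios
  obtain ⟨G, hG, hGm, hGs⟩ := (hX.and hW.cont).exists_measurable_mem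
  set w : Ω → ℝ → Euc 2 := fun ω s =>
    G.indicator (fun ω => Real.sqrt (2*ν) • (W s ω - W t ω)) ω with hw
  have hwG : ∀ ω ∈ G, ∀ s, w ω s = Real.sqrt (2*ν) • (W s ω - W t ω) := fun ω hω s =>
    indicator_of_mem hω _
  have hwc : ∀ ω, Continuous (w ω) := by
    intro ω
    by_cases hω : ω ∈ G
    · have h1 : w ω = fun s => Real.sqrt (2*ν) • (W s ω - W t ω) := funext (hwG ω hω)
      rw [h1]
      exact ((hGs ω hω).2.sub continuous_const).const_smul (Real.sqrt (2*ν))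
    · have h1 : w ω = fun _ => 0 := funext fun s => indicator_of_notMem hω _
      rw [h1]
      exact continuous_const
  have hwm : ∀ s, Measurable fun ω => w ω s := fun s =>
    (((hW.meas s).sub (hW.meas t)).const_smul (Real.sqrt (2*ν))).indicator hGm
  obtain ⟨Φ, hΦ, hid⟩ := vr_family hv hM (by linarith : (1:ℝ) ≤ p) hDb hwc hwm ht.2
  have hXΦ : ∀ ω ∈ G, ∀ x, X t 0 x ω = Φ ω x := by
    intro ω hω x
    refine hid ω (fun s => X t s x ω) x fun s hs => ?_
    rw [hwG ω hω s]
    have h1 := (hGs ω hω).1 x t s ht.1 hs.1 hs.2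
    have h2 : ∫ r in t..s, u (max (-T) (min r 0)) (X t r x ω) = ∫ r in t..s, u r (X t r x ω) := by
      refine intervalIntegral.integral_congr fun r hr => ?_
      rw [uIcc_of_le hs.1] at hr
      have h3 : max (-T) (min r 0) = r := by
        rw [min_eq_left (hr.2.trans hs.2), max_eq_right (ht.1.trans hr.1)]
      simp only [h3]
    rw [h2]
    exact h1
  have hDfin : ENNReal.ofReal (Real.exp (L * (0 - t)) ^ 3 * (0 - t)) * D ≠ ∞ :=
    ENNReal.mul_ne_top ENNReal.ofReal_ne_top hD
  have hrepr : ∀ x, curl2 (u t) x = ∫ ω, curl2 u₀ (Φ ω x) ∂(ℙ : Measure Ω) := by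
    obtain ⟨q, hq⟩ := hP.1
      (fun x => ∫ ω, (tJac (fun y => X t 0 y ω) x) (u₀ (X t 0 x ω)) ∂(ℙ : Measure Ω))
    rw [← hPu t ht] at hq
    refine hΦ.repr hDfin (by linarith) ℙ hu01 ((hreg' t ht).1.of_le (by norm_num)) hB hK hKt
      (q := q) fun x => ?_
    rw [← hq x]
    refine integral_congr_ae ?_
    filter_upwards [hG] with ω hω
    have h1 : (fun y => X t 0 y ω) = Φ ω := funext (hXΦ ω hω)
    rw [h1, hXΦ ω hω x]
  refine ⟨fun x => ?_, fun q hq => ?_⟩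
  · rw [hrepr x]
    refine integral_congr_ae ?_
    filter_upwards [hG] with ω hω
    rw [hXΦ ω hω x]
  · have h1 : curl2 (u t) = fun x => ∫ ω, curl2 u₀ (Φ ω x) ∂(ℙ : Measure Ω) := funext hrepr
    rw [h1]
    exact hΦ.lq ℙ (curl2_cont hu01) hq
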